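/- arXiv:1501.02470 — 4 statements merged into one kernel-verified Lean document; each statement's English description precedes it below -/
import Mathlib

section
/- Let K be a finite field with |K| = q and let W be a finite-dimensional K-vector space. Let (U,V) be a pair of tuples of length m = q+1 of Type B: there exist a subspace S ⊆ W, linearly independent vectors a, b, c ∈ W with S ∩ span{a,b,c} = {0}, and an enumeration α_1, …, α_q of the elements of K, such that V_m = S + span{a}, V_i = S + span{b, α_i a + c} for i ∈ {1,…,q}, U_m = S + span{b}, and U_i = S + span{a, α_i b + c} for i ∈ {1,…,q}. Then (U,V) is a nontrivial solution of the isometry equation, max_i dim_K V_i = max_i dim_K U_i = dim_K S + 2 = n, and exactly one space in each tuple (namely V_m and U_m) has dimension n−1. -/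
open Finset
open scoped Classical

/-- The pair of tuples `(U, V)` is a solution of the isometry equation
`∑ i, (1/|V i|) • 1_{V i} = ∑ i, (1/|U i|) • 1_{U i}` as real-valued functions on `W`. -/
def IsometrySolution {K W : Type*} [Field K] [AddCommGroup W] [Module K W]
    {m : ℕ} (U V : Fin m → Submodule K W) : Prop :=
  ∀ w : W,
    ∑ i, ((Nat.card ↥(V i) : ℝ))⁻¹ * (if w ∈ V i then 1 else 0) =
    ∑ i, ((Nat.card ↥(U i) : ℝ))⁻¹ * (if w ∈ U i then 1 else 0)

/-- Two tuples of subspaces are equivalent if one is a permutation of the other. -/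
def TuplesEquiv {K W : Type*} [Field K] [AddCommGroup W] [Module K W]
    {m : ℕ} (U V : Fin m → Submodule K W) : Prop :=
  ∃ π : Equiv.Perm (Fin m), ∀ i, V i = U (π i)

/-- The vectors `a, b, c` are linearly independent modulo `S`. -/
def IndepModulo {K W : Type*} [Field K] [AddCommGroup W] [Module K W]
    (S : Submodule K W) (a b c : W) : Prop :=
  ∀ s ∈ S, ∀ x y z : K, s + x • a + y • b + z • c = 0 → x = 0 ∧ y = 0 ∧ z = 0

namespace IndepModulo

variable {K W : Type*} [Field K] [AddCommGroup W] [Module K W] {S : Submodule K W} {a b c : W}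

theorem of_linearIndependent (habc : LinearIndependent K ![a, b, c])
    (hS : S ⊓ Submodule.span K {a, b, c} = ⊥) : IndepModulo S a b c := by
  intro s hs x y z h
  have hmem : x • a + y • b + z • c ∈ Submodule.span K {a, b, c} :=
    Submodule.mem_span_triple.2 ⟨x, y, z, rfl⟩
  have hneg : x • a + y • b + z • c = -s := by
    rw [eq_neg_iff_add_eq_zero, ← h]; abel
  have hzero : x • a + y • b + z • c ∈ S ⊓ Submodule.span K {a, b, c} :=
    ⟨hneg ▸ S.neg_mem hs, hmem⟩
  rw [hS, Submodule.mem_bot] at hzero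
  have hcoeff := Fintype.linearIndependent_iff.1 habc ![x, y, z]
    (by simpa [Fin.sum_univ_three] using hzero)
  exact ⟨hcoeff 0, hcoeff 1, hcoeff 2⟩

theorem swap (h : IndepModulo S a b c) : IndepModulo S b a c := by
  intro s hs x y z hw
  obtain ⟨hy, hx, hz⟩ := h s hs y x z (by rw [← hw]; abel)
  exact ⟨hx, hy, hz⟩

theorem mem_sup_span_singleton (h : IndepModulo S a b c) {s : W} (hs : s ∈ S) (x y z : K) :
    s + x • a + y • b + z • c ∈ S ⊔ Submodule.span K {a} ↔ y = 0 ∧ z = 0 := by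
  constructor
  · intro hw
    obtain ⟨t, ht, v, hv, hw⟩ := Submodule.mem_sup.1 hw
    obtain ⟨u, rfl⟩ := Submodule.mem_span_singleton.1 hv
    exact (h (s - t) (S.sub_mem hs ht) (x - u) y z (by
      rw [← sub_eq_zero.2 hw.symm]; module)).2
  · rintro ⟨rfl, rfl⟩
    exact Submodule.mem_sup.2
      ⟨s, hs, x • a, Submodule.mem_span_singleton.2 ⟨x, rfl⟩, by module⟩

theorem mem_sup_span_pair (h : IndepModulo S a b c) {s : W} (hs : s ∈ S) (x y z t : K) :
    s + x • a + y • b + z • c ∈ S ⊔ Submodule.span K {b, t • a + c} ↔ x = t * z := by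
  constructor
  · intro hw
    obtain ⟨r, hr, v, hv, hw⟩ := Submodule.mem_sup.1 hw
    obtain ⟨u, p, rfl⟩ := Submodule.mem_span_pair.1 hv
    obtain ⟨hx, -, hz⟩ := h (s - r) (S.sub_mem hs hr) (x - p * t) (y - u) (z - p) (by
      rw [← sub_eq_zero.2 hw.symm]; module)
    rw [sub_eq_zero] at hx hz
    rw [hx, hz, mul_comm]
  · rintro rfl
    exact Submodule.mem_sup.2
      ⟨s, hs, y • b + z • (t • a + c), Submodule.mem_span_pair.2 ⟨y, z, rfl⟩, by module⟩

theorem finrank_sup_span_singleton [FiniteDimensional K W] (h : IndepModulo S a b c) :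
    Module.finrank K ↥(S ⊔ Submodule.span K {a}) = Module.finrank K S + 1 := by
  have ha : a ≠ 0 := by
    rintro rfl
    simpa using h 0 S.zero_mem 1 0 0 (by simp)
  have hinf : S ⊓ Submodule.span K {a} = ⊥ := by
    rw [eq_bot_iff]
    rintro w ⟨hwS, hw⟩
    obtain ⟨u, rfl⟩ := Submodule.mem_span_singleton.1 hw
    have hu := (h _ hwS (-u) 0 0 (by module)).1
    simp [neg_eq_zero.1 hu]
  have hdim := Submodule.finrank_sup_add_finrank_inf_eq S (Submodule.span K {a})
  rwa [hinf, finrank_bot, add_zero, finrank_span_singleton ha] at hdim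

theorem finrank_sup_span_pair [FiniteDimensional K W] (h : IndepModulo S a b c) (t : K) :
    Module.finrank K ↥(S ⊔ Submodule.span K {b, t • a + c}) = Module.finrank K S + 2 := by
  have hli : LinearIndependent K ![b, t • a + c] := by
    rw [LinearIndependent.pair_iff]
    intro u p hup
    exact (h 0 S.zero_mem (p * t) u p (by rw [zero_add, ← hup]; module)).2
  have hspan : Module.finrank K ↥(Submodule.span K {b, t • a + c}) = 2 := by
    have hrange : Set.range ![b, t • a + c] = {b, t • a + c} := by simp [Set.pair_comm]
    rw [← hrange, finrank_span_eq_card hli, Fintype.card_fin]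
  have hinf : S ⊓ Submodule.span K {b, t • a + c} = ⊥ := by
    rw [eq_bot_iff]
    rintro w ⟨hwS, hw⟩
    obtain ⟨u, p, rfl⟩ := Submodule.mem_span_pair.1 hw
    obtain ⟨-, hu, hp⟩ := h _ hwS (-(p * t)) (-u) (-p) (by module)
    simp [neg_eq_zero.1 hu, neg_eq_zero.1 hp]
  have hdim := Submodule.finrank_sup_add_finrank_inf_eq S (Submodule.span K {b, t • a + c})
  rwa [hinf, finrank_bot, add_zero, hspan] at hdim

end IndepModulo

theorem mem_sup_span_triple_iff {K W : Type*} [Field K] [AddCommGroup W] [Module K W]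
    {S : Submodule K W} {a b c w : W} :
    w ∈ S ⊔ Submodule.span K {a, b, c} ↔
      ∃ s ∈ S, ∃ x y z : K, s + x • a + y • b + z • c = w := by
  simp only [Submodule.mem_sup, Submodule.mem_span_triple]
  constructor
  · rintro ⟨s, hs, _, ⟨x, y, z, rfl⟩, rfl⟩
    exact ⟨s, hs, x, y, z, by abel⟩
  · rintro ⟨s, hs, x, y, z, rfl⟩
    exact ⟨s, hs, _, ⟨x, y, z, rfl⟩, by abel⟩

theorem sum_ite_eq_mul {K : Type*} [Field K] [Fintype K] (x z : K) :
    ∑ t : K, (if x = t * z then (1 : ℝ) else 0) =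
      if z = 0 then (Fintype.card K : ℝ) * (if x = 0 then 1 else 0) else 1 := by
  split_ifs with hz hx
  · simp [hz, hx]
  · simp [hz, hx]
  · simp [← div_eq_iff hz]

/-- One side of the isometry equation for a tuple of Type B, evaluated at
`s + x • a + y • b + z • c`. -/
theorem typeB_sum_eq {K W : Type*} [Field K] [Fintype K] [AddCommGroup W] [Module K W]
    [FiniteDimensional K W] {S : Submodule K W} {a b c : W} (h : IndepModulo S a b c)
    {α : Fin (Fintype.card K) → K} (hα : Function.Bijective α)
    {V : Fin (Fintype.card K + 1) → Submodule K W}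
    (hVlast : V (Fin.last (Fintype.card K)) = S ⊔ Submodule.span K {a})
    (hV : ∀ i : Fin (Fintype.card K),
      V i.castSucc = S ⊔ Submodule.span K {b, α i • a + c})
    {s : W} (hs : s ∈ S) (x y z : K) :
    ∑ i, ((Nat.card ↥(V i) : ℝ))⁻¹ *
        (if s + x • a + y • b + z • c ∈ V i then 1 else 0) =
      ((Fintype.card K : ℝ) ^ (Module.finrank K S + 2))⁻¹ *
        if z = 0 then
          (Fintype.card K : ℝ) * ((if x = 0 then 1 else 0) + if y = 0 then 1 else 0)
        else 1 := by
  have hq : (Fintype.card K : ℝ) ≠ 0 := by simp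
  have hcard (T : Submodule K W) :
      (Nat.card T : ℝ) = (Fintype.card K : ℝ) ^ Module.finrank K T := by
    rw [Module.natCard_eq_pow_finrank (K := K), Nat.card_eq_fintype_card, Nat.cast_pow]
  rw [Fin.sum_univ_castSucc]
  simp only [hVlast, hV, h.mem_sup_span_singleton hs, h.mem_sup_span_pair hs,
    hcard, h.finrank_sup_span_singleton, h.finrank_sup_span_pair]
  rw [← Finset.mul_sum, hα.sum_comp fun t => if x = t * z then (1 : ℝ) else 0, sum_ite_eq_mul]
  by_cases hz : z = 0
  · simp only [hz, and_true, if_true]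
    field_simp
    ring
  · simp [hz]

/-- The spaces of a tuple of Type B lie in `S ⊔ span {a, b, c}`. -/
theorem typeB_le {K W : Type*} [Field K] [Fintype K] [AddCommGroup W] [Module K W]
    {S : Submodule K W} {a b c : W} {α : Fin (Fintype.card K) → K}
    {V : Fin (Fintype.card K + 1) → Submodule K W}
    (hVlast : V (Fin.last (Fintype.card K)) = S ⊔ Submodule.span K {a})
    (hV : ∀ i : Fin (Fintype.card K),
      V i.castSucc = S ⊔ Submodule.span K {b, α i • a + c})
    (i : Fin (Fintype.card K + 1)) : V i ≤ S ⊔ Submodule.span K {a, b, c} := by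
  have ha : a ∈ Submodule.span K {a, b, c} := Submodule.subset_span (by simp)
  have hb : b ∈ Submodule.span K {a, b, c} := Submodule.subset_span (by simp)
  have hc : c ∈ Submodule.span K {a, b, c} := Submodule.subset_span (by simp)
  induction i using Fin.lastCases with
  | last =>
    rw [hVlast]
    exact sup_le_sup_left (by simpa [Submodule.span_le] using ha) S
  | cast i =>
    rw [hV]
    refine sup_le_sup_left (Submodule.span_le.2 ?_) S
    rintro w (rfl | rfl)
    · exact hb
    · exact Submodule.add_mem _ (Submodule.smul_mem _ _ ha) hc

theorem sup_univ_eq_of_last_le {n d : ℕ} [NeZero n] {f : Fin (n + 1) → ℕ}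
    (hlast : f (Fin.last n) ≤ d) (hf : ∀ i : Fin n, f i.castSucc = d) :
    Finset.univ.sup f = d := by
  refine le_antisymm (Finset.sup_le fun i _ => ?_) ?_
  · induction i using Fin.lastCases with
    | last => exact hlast
    | cast i => exact (hf i).le
  · rw [← hf 0]
    exact Finset.le_sup (Finset.mem_univ _)

/-- A pair of Type B is a nontrivial solution of the isometry equation; all its spaces have
dimension `dim S + 2`, except `V (last)` and `U (last)`, which have dimension `dim S + 1`. -/
theorem typeB_is_nontrivial_solution
    (K W : Type*) [Field K] [Fintype K] [AddCommGroup W] [Module K W]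
    [FiniteDimensional K W]
    (S : Submodule K W) (a b c : W)
    (habc : LinearIndependent K ![a, b, c])
    (hSabc : S ⊓ Submodule.span K {a, b, c} = ⊥)
    (α : Fin (Fintype.card K) → K) (hα : Function.Bijective α)
    (U V : Fin (Fintype.card K + 1) → Submodule K W)
    (hVlast : V (Fin.last (Fintype.card K)) = S ⊔ Submodule.span K {a})
    (hV : ∀ i : Fin (Fintype.card K),
      V i.castSucc = S ⊔ Submodule.span K {b, α i • a + c})
    (hUlast : U (Fin.last (Fintype.card K)) = S ⊔ Submodule.span K {b})
    (hU : ∀ i : Fin (Fintype.card K),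
      U i.castSucc = S ⊔ Submodule.span K {a, α i • b + c}) :
    IsometrySolution U V ∧ ¬ TuplesEquiv U V ∧
    (Finset.univ.sup fun i => Module.finrank K ↥(V i)) = Module.finrank K ↥S + 2 ∧
    (Finset.univ.sup fun i => Module.finrank K ↥(U i)) = Module.finrank K ↥S + 2 ∧
    Module.finrank K ↥(V (Fin.last (Fintype.card K))) = Module.finrank K ↥S + 1 ∧
    Module.finrank K ↥(U (Fin.last (Fintype.card K))) = Module.finrank K ↥S + 1 ∧
    (∀ i : Fin (Fintype.card K),
      Module.finrank K ↥(V i.castSucc) = Module.finrank K ↥S + 2 ∧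
      Module.finrank K ↥(U i.castSucc) = Module.finrank K ↥S + 2) := by
  have h := IndepModulo.of_linearIndependent habc hSabc
  have hVl : Module.finrank K ↥(V (Fin.last (Fintype.card K))) = Module.finrank K ↥S + 1 := by
    rw [hVlast, h.finrank_sup_span_singleton]
  have hUl : Module.finrank K ↥(U (Fin.last (Fintype.card K))) = Module.finrank K ↥S + 1 := by
    rw [hUlast, h.swap.finrank_sup_span_singleton]
  have hVd (i : Fin (Fintype.card K)) :
      Module.finrank K ↥(V i.castSucc) = Module.finrank K ↥S + 2 := by
    rw [hV, h.finrank_sup_span_pair]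
  have hUd (i : Fin (Fintype.card K)) :
      Module.finrank K ↥(U i.castSucc) = Module.finrank K ↥S + 2 := by
    rw [hU, h.swap.finrank_sup_span_pair]
  have : NeZero (Fintype.card K) := ⟨Fintype.card_ne_zero⟩
  refine ⟨fun w => ?_, ?_, sup_univ_eq_of_last_le (by omega) hVd,
    sup_univ_eq_of_last_le (by omega) hUd, hVl, hUl, fun i => ⟨hVd i, hUd i⟩⟩
  · by_cases hw : w ∈ S ⊔ Submodule.span K {a, b, c}
    · obtain ⟨s, hs, x, y, z, rfl⟩ := mem_sup_span_triple_iff.1 hw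
      rw [typeB_sum_eq h hα hVlast hV hs, add_right_comm s,
        typeB_sum_eq h.swap hα hUlast hU hs, add_comm (if x = 0 then (1 : ℝ) else 0)]
    · have hVw (i) : w ∉ V i := fun hi => hw (typeB_le hVlast hV i hi)
      have hUw (i) : w ∉ U i := fun hi =>
        hw (Set.insert_comm a b {c} ▸ typeB_le hUlast hU i hi)
      simp [hVw, hUw]
  · rintro ⟨π, hπ⟩
    have hlast := hπ (Fin.last _)
    have ha : a ∈ V (Fin.last _) := by
      rw [hVlast]
      exact Submodule.mem_sup_right (Submodule.mem_span_singleton_self a)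
    rw [hlast] at ha hVl
    generalize π (Fin.last _) = j at ha hVl
    induction j using Fin.lastCases with
    | last =>
      rw [hUlast] at ha
      have := h.swap.mem_sup_span_singleton S.zero_mem 0 1 0
      simp [ha] at this
    | cast j =>
      have := hUd j
      omega
end

section
/- Let K be a finite field with |K| = q, let W be a finite-dimensional K-vector space, and let (U,V) be a nontrivial solution of the isometry equation with tuples of length m = q+1 such that all spaces V_1, …, V_m, U_1, …, U_m have the same dimension n > 1. Then (U,V) is equivalent to a pair of Type C: there exist a subspace S ⊆ W, linearly independent vectors a, b, c, d ∈ W with S ∩ span{a,b,c,d} = {0}, an enumeration [α_1 : β_1], …, [α_m : β_m] of the q+1 points of the projective line over K, and permutations of the two tuples, after which V_i = S + span{α_i a + β_i b, α_i c + β_i d} and U_i = S + span{α_i a + β_i c, α_i b + β_i d} for all i ∈ {1,…,m}. -/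
open Finset
open scoped Classical

section Cover

variable {K W ι : Type*} [Field K] [AddCommGroup W] [Module K W]

/-- If `v` lies in none of the subspaces `A i` with `i ∈ s`, then the points of the affine line
`w + K v` lie in pairwise distinct members of `s`. -/
theorem exists_injective_of_line_covered (A : ι → Submodule K W) (s : Finset ι) {v w : W}
    (hv : ∀ i ∈ s, v ∉ A i) (hw : ∀ c : K, ∃ i ∈ s, w + c • v ∈ A i) :
    ∃ f : K → s, Function.Injective f ∧ ∀ c, w + c • v ∈ A (f c) := by
  choose f hfs hf using hw
  refine ⟨fun c => ⟨f c, hfs c⟩, fun c c' h => ?_, hf⟩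
  by_contra hne
  have h' : f c = f c' := congrArg Subtype.val h
  have h1 := (A (f c)).sub_mem (hf c) (h' ▸ hf c')
  rw [add_sub_add_left_eq_sub, ← sub_smul] at h1
  exact hv _ (hfs c) (((A (f c)).smul_mem_iff (sub_ne_zero.2 hne)).1 h1)

variable [Fintype K]

theorem exists_le_of_forall_mem_of_card_le (A : ι → Submodule K W) (V : Submodule K W)
    (s : Finset ι) (hs : s.card ≤ Fintype.card K) (hV : ∀ w ∈ V, ∃ i ∈ s, w ∈ A i) :
    ∃ i ∈ s, V ≤ A i := by
  induction s using Finset.induction_on with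
  | empty => simpa using hV 0 V.zero_mem
  | insert j s hj ih =>
    rw [card_insert_of_notMem hj] at hs
    by_cases hVj : V ≤ A j
    · exact ⟨j, mem_insert_self _ _, hVj⟩
    by_cases hVs : ∀ w ∈ V, ∃ i ∈ s, w ∈ A i
    · obtain ⟨i, hi, h⟩ := ih (by omega) hVs
      exact ⟨i, mem_insert_of_mem hi, h⟩
    exfalso
    push Not at hVs
    obtain ⟨v, hvV, hv⟩ := hVs
    obtain ⟨w, hwV, hw⟩ := SetLike.not_le_iff_exists.1 hVj
    have hvj : v ∈ A j := by
      obtain ⟨i, hi, h⟩ := hV v hvV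
      rcases mem_insert.1 hi with rfl | hi
      · exact h
      · exact absurd h (hv i hi)
    obtain ⟨f, hf, -⟩ := exists_injective_of_line_covered A s (w := w) hv fun c => by
      obtain ⟨i, hi, h⟩ := hV _ (V.add_mem hwV (V.smul_mem c hvV))
      rcases mem_insert.1 hi with rfl | hi
      · exact absurd (((A i).add_mem_iff_left ((A i).smul_mem c hvj)).1 h) hw
      · exact ⟨i, hi, h⟩
    have := Fintype.card_le_of_injective f hf
    rw [Fintype.card_coe] at this
    omega

variable [Fintype ι]

/-- In a cover of `V` by `|K| + 1` proper subspaces, some `v ∈ V` lies in `A k` only, and every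
other member meets every affine line of `V` in direction `v` outside `A k`. -/
theorem exists_line_meets_of_cover (hι : Fintype.card ι = Fintype.card K + 1)
    (A : ι → Submodule K W) (V : Submodule K W) (hV : ∀ w ∈ V, ∃ i, w ∈ A i)
    (hA : ∀ i, ¬ V ≤ A i) (k : ι) :
    ∃ v ∈ V, (∀ i ≠ k, v ∉ A i) ∧ ∀ w ∈ V, w ∉ A k →
      ∃ f : K → ι, (∀ i ≠ k, ∃ c, f c = i) ∧ ∀ c, w + c • v ∈ A (f c) := by
  have hcard : (univ.erase k).card = Fintype.card K := by
    rw [card_erase_of_mem (mem_univ k), card_univ, hι]; rfl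
  obtain ⟨v, hvV, hv⟩ : ∃ v ∈ V, ∀ i ≠ k, v ∉ A i := by
    by_contra! h
    obtain ⟨i, -, hi⟩ := exists_le_of_forall_mem_of_card_le A V (univ.erase k) hcard.le
      fun w hw => by
        obtain ⟨i, hi, h⟩ := h w hw
        exact ⟨i, by simpa using hi, h⟩
    exact hA i hi
  have hvk : v ∈ A k := by
    obtain ⟨i, hi⟩ := hV v hvV
    by_contra h
    exact hv i (fun hik => h (hik ▸ hi)) hi
  refine ⟨v, hvV, hv, fun w hwV hw => ?_⟩
  obtain ⟨f, hf, hfA⟩ := exists_injective_of_line_covered A (univ.erase k) (v := v) (w := w)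
    (fun i hi => hv i (by simpa using hi)) fun c => by
      obtain ⟨i, h⟩ := hV _ (V.add_mem hwV (V.smul_mem c hvV))
      refine ⟨i, ?_, h⟩
      simp only [mem_erase, mem_univ, and_true]
      rintro rfl
      exact hw (((A i).add_mem_iff_left ((A i).smul_mem c hvk)).1 h)
  have hbij : Function.Bijective f := by
    rw [Fintype.bijective_iff_injective_and_card, Fintype.card_coe, hcard]
    exact ⟨hf, rfl⟩
  refine ⟨fun c => f c, fun i hi => ?_, hfA⟩
  obtain ⟨c, hc⟩ := hbij.2 ⟨i, by simpa using hi⟩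
  exact ⟨c, congrArg Subtype.val hc⟩

theorem mem_of_mem_of_mem_of_cover (hι : Fintype.card ι = Fintype.card K + 1)
    (A : ι → Submodule K W) (V : Submodule K W) (hV : ∀ w ∈ V, ∃ i, w ∈ A i)
    (hA : ∀ i, ¬ V ≤ A i) {i j : ι} (hij : i ≠ j) (k : ι) {w : W} (hw : w ∈ V)
    (hi : w ∈ A i) (hj : w ∈ A j) : w ∈ A k := by
  by_contra hk
  have hik : i ≠ k := by rintro rfl; exact hk hi
  have hjk : j ≠ k := by rintro rfl; exact hk hj
  obtain ⟨v, -, hv, H⟩ := exists_line_meets_of_cover hι A V hV hA k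
  obtain ⟨f, hf, hfA⟩ := H w hw hk
  obtain ⟨c, rfl⟩ := hf i hik
  obtain ⟨d, rfl⟩ := hf j hjk
  have key : ∀ e, w ∈ A (f e) → f e ≠ k → e = 0 := fun e h1 h2 => by
    by_contra he
    exact hv _ h2 (((A (f e)).smul_mem_iff he).1 (((A (f e)).add_mem_iff_right h1).1 (hfA e)))
  exact hij (by rw [key c hi hik, key d hj hjk])

theorem finrank_inf_of_cover [FiniteDimensional K W]
    (hι : Fintype.card ι = Fintype.card K + 1)
    (A : ι → Submodule K W) (V : Submodule K W) (hV : ∀ w ∈ V, ∃ i, w ∈ A i)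
    (hA : ∀ i, ¬ V ≤ A i) (i : ι) :
    Module.finrank K ↥(V ⊓ A i) + 1 = Module.finrank K V := by
  obtain ⟨k, hk⟩ : ∃ k, i ≠ k := by
    have : Nontrivial ι := Fintype.one_lt_card_iff_nontrivial.1 (by
      have := Fintype.card_pos (α := K); omega)
    exact (exists_ne i).imp fun _ => Ne.symm
  obtain ⟨v, hvV, hv, H⟩ := exists_line_meets_of_cover hι A V hV hA k
  have hout : ∀ w ∈ V, w ∉ A k → w ∈ (V ⊓ A i) ⊔ Submodule.span K {v} := by
    intro w hw hwk
    obtain ⟨f, hf, hfA⟩ := H w hw hwk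
    obtain ⟨c, rfl⟩ := hf i hk
    rw [show w = (w + c • v) + (-c) • v by module]
    exact Submodule.add_mem_sup ⟨V.add_mem hw (V.smul_mem c hvV), hfA c⟩
      (Submodule.smul_mem _ _ (Submodule.mem_span_singleton_self v))
  have hsup : (V ⊓ A i) ⊔ Submodule.span K {v} = V := by
    refine le_antisymm (sup_le inf_le_left (by simpa using hvV)) fun w hw => ?_
    by_cases hwk : w ∈ A k
    · obtain ⟨u, huV, hu⟩ := SetLike.not_le_iff_exists.1 (hA k)
      have h1 := hout (w + u) (V.add_mem hw huV) fun h => hu (((A k).add_mem_iff_right hwk).1 h)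
      simpa using Submodule.sub_mem _ h1 (hout u huV hu)
    · exact hout w hw hwk
  have hinf : (V ⊓ A i) ⊓ Submodule.span K {v} = ⊥ := by
    rw [← disjoint_iff]
    refine (Submodule.disjoint_span_singleton' ?_).2 fun h => hv i hk h.2
    rintro rfl
    exact hv i hk (A i).zero_mem
  have := Submodule.finrank_sup_add_finrank_inf_eq (V ⊓ A i) (Submodule.span K {v})
  rw [hsup, hinf, finrank_bot, finrank_span_singleton] at this
  · omega
  · rintro rfl
    exact hv i hk (A i).zero_mem

end Cover

section Solutions

theorem tuplesEquiv_of_map_eq {K W : Type*} [Field K] [AddCommGroup W] [Module K W]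
    {m : ℕ} {U V : Fin m → Submodule K W}
    (h : univ.val.map V = univ.val.map U) : TuplesEquiv U V := by
  have hcard : ∀ P, Fintype.card {i // V i = P} = Fintype.card {i // U i = P} := fun P => by
    have := congrArg (Multiset.count P) h
    simp only [Multiset.count_map, eq_comm (a := P)] at this
    rw [Fintype.card_subtype, Fintype.card_subtype]
    exact this
  refine ⟨Equiv.ofFiberEquiv fun P => Fintype.equivOfCardEq (hcard P), fun i => ?_⟩
  exact (Equiv.ofFiberEquiv_map _ i).symm

variable {K W : Type*} [Field K] [Fintype K] [AddCommGroup W] [Module K W]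
  [FiniteDimensional K W]

theorem multiset_eq_of_countP_eq (n : ℕ) (s t : Multiset (Submodule K W))
    (ht : t.card ≤ Fintype.card K)
    (hs_dim : ∀ P ∈ s, Module.finrank K ↥P = n) (ht_dim : ∀ P ∈ t, Module.finrank K ↥P = n)
    (h : ∀ w : W, s.countP (w ∈ ·) = t.countP (w ∈ ·)) : s = t := by
  induction s using Multiset.induction_on generalizing t with
  | empty =>
    have := h 0
    simp only [Submodule.zero_mem, Multiset.countP_True, Multiset.card_zero] at this
    exact (Multiset.card_eq_zero.1 this.symm).symm
  | cons V s ih =>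
    obtain ⟨U, hU, hVU⟩ := exists_le_of_forall_mem_of_card_le id V t.toFinset
      ((Multiset.toFinset_card_le t).trans ht) fun w hw => by
        have : 0 < t.countP (w ∈ ·) := by
          rw [← h w]; exact Multiset.countP_pos.2 ⟨V, Multiset.mem_cons_self _ _, hw⟩
        obtain ⟨U, hU, hwU⟩ := Multiset.countP_pos.1 this
        exact ⟨U, Multiset.mem_toFinset.2 hU, hwU⟩
    rw [Multiset.mem_toFinset] at hU
    obtain rfl : V = U := Submodule.eq_of_le_of_finrank_eq hVU
      ((hs_dim V (Multiset.mem_cons_self _ _)).trans (ht_dim U hU).symm)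
    obtain ⟨t, rfl⟩ := Multiset.exists_cons_of_mem hU
    rw [ih t]
    · rw [Multiset.card_cons] at ht; omega
    · exact fun P hP => hs_dim P (Multiset.mem_cons_of_mem hP)
    · exact fun P hP => ht_dim P (Multiset.mem_cons_of_mem hP)
    · intro w
      have := h w
      simp only [Multiset.countP_cons] at this
      omega

theorem IsometrySolution.countP_eq {m n : ℕ} {U V : Fin m → Submodule K W}
    (hsol : IsometrySolution U V)
    (hdim : ∀ i, Module.finrank K ↥(V i) = n ∧ Module.finrank K ↥(U i) = n) (w : W) :
    (univ.val.map V).countP (w ∈ ·) = (univ.val.map U).countP (w ∈ ·) := by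
  have h := hsol w
  have hV : ∀ i, Nat.card (V i) = Nat.card K ^ n := fun i => by
    rw [Module.natCard_eq_pow_finrank (K := K), (hdim i).1]
  have hU : ∀ i, Nat.card (U i) = Nat.card K ^ n := fun i => by
    rw [Module.natCard_eq_pow_finrank (K := K), (hdim i).2]
  simp only [hV, hU, ← mul_sum, sum_boole] at h
  rw [mul_right_inj' (inv_ne_zero (by simp [Nat.card_eq_fintype_card])), Nat.cast_inj] at h
  simp only [Multiset.countP_map]
  exact h

/-- In a nontrivial solution of length `|K| + 1`, the two tuples have no space in common. -/
theorem IsometrySolution.ne_of_not_tuplesEquiv {n : ℕ}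
    {U V : Fin (Fintype.card K + 1) → Submodule K W}
    (hsol : IsometrySolution U V) (hnontriv : ¬ TuplesEquiv U V)
    (hdim : ∀ i, Module.finrank K ↥(V i) = n ∧ Module.finrank K ↥(U i) = n)
    (i j : Fin (Fintype.card K + 1)) : V i ≠ U j := by
  intro hij
  apply hnontriv
  apply tuplesEquiv_of_map_eq
  obtain ⟨s, hs⟩ := Multiset.exists_cons_of_mem
    (Multiset.mem_map_of_mem V (mem_univ_val i))
  obtain ⟨t, ht⟩ := Multiset.exists_cons_of_mem
    (Multiset.mem_map_of_mem U (mem_univ_val j))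
  have hcount := hsol.countP_eq hdim
  have hVmem : ∀ P ∈ univ.val.map V, Module.finrank K ↥P = n := by
    intro P hP
    obtain ⟨k, -, rfl⟩ := Multiset.mem_map.1 hP
    exact (hdim k).1
  have hUmem : ∀ P ∈ univ.val.map U, Module.finrank K ↥P = n := by
    intro P hP
    obtain ⟨k, -, rfl⟩ := Multiset.mem_map.1 hP
    exact (hdim k).2
  have hcard : t.card ≤ Fintype.card K := by
    have := congrArg Multiset.card ht
    simp at this
    omega
  rw [hs, ht] at hcount
  rw [hs] at hVmem ⊢
  rw [ht] at hUmem ⊢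
  rw [hij]
  congr 1
  refine multiset_eq_of_countP_eq n s t hcard
    (fun P hP => hVmem P (Multiset.mem_cons_of_mem hP))
    (fun P hP => hUmem P (Multiset.mem_cons_of_mem hP)) fun w => ?_
  have := hcount w
  simp only [Multiset.countP_cons, hij] at this
  omega

end Solutions

section Regulus

variable {K X : Type*} [Field K] [AddCommGroup X] [Module K X]

theorem eq_zero_of_add_eq_zero {P Q : Submodule K X} (h : Disjoint P Q) {x y : X}
    (hx : x ∈ P) (hy : y ∈ Q) (hxy : x + y = 0) : x = 0 ∧ y = 0 := by
  obtain rfl : x = -y := eq_neg_of_add_eq_zero_left hxy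
  have := Submodule.disjoint_def.1 h _ hx (Q.neg_mem hy)
  exact ⟨this, neg_eq_zero.1 this⟩

theorem eq_and_eq_of_add_eq_add {P Q : Submodule K X} (h : Disjoint P Q) {x y x' y' : X}
    (hx : x ∈ P) (hy : y ∈ Q) (hx' : x' ∈ P) (hy' : y' ∈ Q) (hxy : x + y = x' + y') :
    x = x' ∧ y = y' := by
  have := eq_zero_of_add_eq_zero h (P.sub_mem hx hx') (Q.sub_mem hy hy')
    (by rw [← sub_eq_zero] at hxy; rw [← hxy]; abel)
  exact ⟨sub_eq_zero.1 this.1, sub_eq_zero.1 this.2⟩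

theorem eq_span_pair_of_disjoint {P Q R : Submodule K X} (hP : Module.finrank K P = 2)
    (hQR : Disjoint Q R) {y z : X} (hyP : y ∈ P) (hzP : z ∈ P) (hyQ : y ∈ Q) (hzR : z ∈ R)
    (hy : y ≠ 0) (hz : z ≠ 0) : P = Submodule.span K {y, z} := by
  have : FiniteDimensional K P := Module.finite_of_finrank_eq_succ hP
  have hli : LinearIndependent K ![y, z] := LinearIndependent.pair_iff.2 fun s t h => by
    have := eq_zero_of_add_eq_zero hQR (Q.smul_mem s hyQ) (R.smul_mem t hzR) h
    simpa [hy, hz] using this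
  have hr : Set.range ![y, z] = {y, z} := by simp [Set.pair_comm]
  refine (Submodule.eq_of_le_of_finrank_eq (Submodule.span_le.2 ?_) ?_).symm
  · rintro x (rfl | rfl)
    exacts [hyP, hzP]
  · rw [← hr, finrank_span_eq_card hli, hP, Fintype.card_fin]

theorem exists_add_of_mem {P Q R : Submodule K X} (hP : Module.finrank K P = 2)
    (hQR : Disjoint Q R) (hQ : P ⊓ Q ≠ ⊥) (hR : P ⊓ R ≠ ⊥) {x : X} (hx : x ∈ P) :
    ∃ y z, x = y + z ∧ y ∈ P ∧ y ∈ Q ∧ z ∈ P ∧ z ∈ R := by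
  obtain ⟨y, ⟨hyP, hyQ⟩, hy⟩ := Submodule.exists_mem_ne_zero_of_ne_bot hQ
  obtain ⟨z, ⟨hzP, hzR⟩, hz⟩ := Submodule.exists_mem_ne_zero_of_ne_bot hR
  rw [eq_span_pair_of_disjoint hP hQR hyP hzP hyQ hzR hy hz, Submodule.mem_span_pair] at hx
  obtain ⟨s, t, rfl⟩ := hx
  exact ⟨s • y, t • z, rfl, P.smul_mem s hyP, Q.smul_mem s hyQ, P.smul_mem t hzP,
    R.smul_mem t hzR⟩

/-- A transversal `P` of the three lines `V₀ = ⟨a, c⟩`, `V₁ = ⟨b, d⟩`, `⟨a + b, c + d⟩` through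
the point `s a + t c` is the line `⟨s a + t c, s b + t d⟩`. -/
theorem transversal_eq_span {V₀ V₁ P : Submodule K X} (hV : Disjoint V₀ V₁) {a b c d : X}
    (ha : a ∈ V₀) (hc : c ∈ V₀) (hb : b ∈ V₁) (hd : d ∈ V₁)
    (hac : LinearIndependent K ![a, c]) (hbd : LinearIndependent K ![b, d])
    (hP : Module.finrank K P = 2) (h₀ : P ⊓ V₀ ≠ ⊥) (h₁ : P ⊓ V₁ ≠ ⊥)
    (h₂ : P ⊓ Submodule.span K {a + b, c + d} ≠ ⊥) (hacP : a ∈ P → c ∉ P) {s t : K}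
    (hst : (s, t) ≠ 0) (hmem : s • a + t • c ∈ P) :
    P = Submodule.span K {s • a + t • c, s • b + t • d} := by
  rw [LinearIndependent.pair_iff] at hac hbd
  have hst' : ¬ (s = 0 ∧ t = 0) := by simpa [Prod.ext_iff] using hst
  obtain ⟨p, ⟨hpP, hp⟩, hp0⟩ := Submodule.exists_mem_ne_zero_of_ne_bot h₂
  obtain ⟨s', t', rfl⟩ := Submodule.mem_span_pair.1 hp
  obtain ⟨y, z, hyz, hyP, hyV, hzP, hzV⟩ := exists_add_of_mem hP hV h₀ h₁ hpP
  obtain ⟨rfl, rfl⟩ := eq_and_eq_of_add_eq_add hV hyV hzV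
    (V₀.add_mem (V₀.smul_mem s' ha) (V₀.smul_mem t' hc))
    (V₁.add_mem (V₁.smul_mem s' hb) (V₁.smul_mem t' hd))
    (by rw [← hyz]; module)
  have hdet : s * t' = s' * t := by
    by_contra hne
    have hne' : s * t' - s' * t ≠ 0 := sub_ne_zero.2 hne
    refine hacP ((P.smul_mem_iff hne').1 ?_) ((P.smul_mem_iff hne').1 ?_)
    · rw [show (s * t' - s' * t) • a
        = t' • (s • a + t • c) - t • (s' • a + t' • c) by module]
      exact P.sub_mem (P.smul_mem _ hmem) (P.smul_mem _ hyP)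
    · rw [show (s * t' - s' * t) • c
        = s • (s' • a + t' • c) - s' • (s • a + t • c) by module]
      exact P.sub_mem (P.smul_mem _ hyP) (P.smul_mem _ hmem)
  have hst0 : ¬ (s' = 0 ∧ t' = 0) := by
    rintro ⟨rfl, rfl⟩
    simp at hp0
  have hmem' : s • b + t • d ∈ P := by
    by_cases hs : s = 0
    · subst hs
      have ht : t ≠ 0 := fun h => hst' ⟨rfl, h⟩
      obtain rfl : s' = 0 := by simpa [ht] using hdet.symm
      have ht' : t' ≠ 0 := fun h => hst0 ⟨rfl, h⟩
      rw [zero_smul, zero_add] at hzP ⊢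
      exact P.smul_mem _ ((P.smul_mem_iff ht').1 hzP)
    · have hs' : s' ≠ 0 := by
        rintro rfl
        exact hst0 ⟨rfl, by simpa [hs] using hdet⟩
      refine (P.smul_mem_iff hs').1 ?_
      rw [show s' • (s • b + t • d) = s • s' • b + (s' * t) • d by module, ← hdet,
        show s • s' • b + (s * t') • d = s • (s' • b + t' • d) by module]
      exact P.smul_mem _ hzP
  exact eq_span_pair_of_disjoint hP hV hmem hmem'
    (V₀.add_mem (V₀.smul_mem s ha) (V₀.smul_mem t hc))
    (V₁.add_mem (V₁.smul_mem s hb) (V₁.smul_mem t hd))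
    (fun h => hst' (hac _ _ h)) (fun h => hst' (hbd _ _ h))

/-- If every point of the line `V₀ = ⟨a, c⟩` lies on a member of the family `U` of transversals,
then `U` is the full set of transversals `⟨α a + β c, α b + β d⟩`. -/
theorem exists_perm_eq_span {ι : Type*} [Finite ι] {U : ι → Submodule K X}
    {V₀ V₁ : Submodule K X} (hV : Disjoint V₀ V₁) {a b c d : X}
    (ha : a ∈ V₀) (hc : c ∈ V₀) (hb : b ∈ V₁) (hd : d ∈ V₁)
    (hac : LinearIndependent K ![a, c]) (hbd : LinearIndependent K ![b, d])
    (hU : ∀ i, Module.finrank K (U i) = 2) (h₀ : ∀ i, U i ⊓ V₀ ≠ ⊥) (h₁ : ∀ i, U i ⊓ V₁ ≠ ⊥)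
    (h₂ : ∀ i, U i ⊓ Submodule.span K {a + b, c + d} ≠ ⊥) (hacU : ∀ i, a ∈ U i → c ∉ U i)
    (hcover : ∀ x ∈ V₀, ∃ i, x ∈ U i) {α β : ι → K} (hαβ : ∀ i, (α i, β i) ≠ 0)
    (hne : ∀ i j, i ≠ j → α i * β j ≠ α j * β i) :
    ∃ τ : Equiv.Perm ι, ∀ i,
      U (τ i) = Submodule.span K {α i • a + β i • c, α i • b + β i • d} := by
  choose τ hτ using fun i => hcover (α i • a + β i • c)
    (V₀.add_mem (V₀.smul_mem _ ha) (V₀.smul_mem _ hc))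
  have hinj : Function.Injective τ := fun i j hij => by
    by_contra hij'
    have hdet : α i * β j - α j * β i ≠ 0 := sub_ne_zero.2 (hne i j hij')
    have hi := hτ i
    rw [hij] at hi
    have hj := hτ j
    refine hacU (τ j) (((U (τ j)).smul_mem_iff hdet).1 ?_) (((U (τ j)).smul_mem_iff hdet).1 ?_)
    · rw [show (α i * β j - α j * β i) • a
        = β j • (α i • a + β i • c) - β i • (α j • a + β j • c) by module]
      exact Submodule.sub_mem _ (Submodule.smul_mem _ _ hi) (Submodule.smul_mem _ _ hj)
    · rw [show (α i * β j - α j * β i) • c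
        = α i • (α j • a + β j • c) - α j • (α i • a + β i • c) by module]
      exact Submodule.sub_mem _ (Submodule.smul_mem _ _ hj) (Submodule.smul_mem _ _ hi)
  exact ⟨Equiv.ofBijective τ (Finite.injective_iff_bijective.1 hinj), fun i =>
    transversal_eq_span hV ha hc hb hd hac hbd (hU _) (h₀ _) (h₁ _) (h₂ _) (hacU _) (hαβ i)
      (hτ i)⟩

/-- Two opposite families of pairwise skew lines, each covering the lines of the other, form a
regulus and its opposite. -/
theorem exists_regulus_basis {ι : Type*} [Finite ι] {U V : ι → Submodule K X}
    {i₀ i₁ i₂ : ι} (h01 : i₀ ≠ i₁) (h02 : i₀ ≠ i₂) (h12 : i₁ ≠ i₂)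
    (hV : ∀ i, Module.finrank K (V i) = 2) (hU : ∀ i, Module.finrank K (U i) = 2)
    (hVV : ∀ i j, i ≠ j → Disjoint (V i) (V j)) (hUU : ∀ i j, i ≠ j → Disjoint (U i) (U j))
    (hVU : ∀ i j, V i ⊓ U j ≠ ⊥)
    (hVcover : ∀ i, ∀ x ∈ V i, ∃ j, x ∈ U j) (hUcover : ∀ j, ∀ x ∈ U j, ∃ i, x ∈ V i) :
    ∃ a b c d : X, LinearIndependent K ![a, b, c, d] ∧
      ∀ α β : ι → K, (∀ i, (α i, β i) ≠ 0) → (∀ i j, i ≠ j → α i * β j ≠ α j * β i) →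
        ∃ σ τ : Equiv.Perm ι,
          (∀ i, V (σ i) = Submodule.span K {α i • a + β i • b, α i • c + β i • d}) ∧
          (∀ i, U (τ i) = Submodule.span K {α i • a + β i • c, α i • b + β i • d}) := by
  have hUV : ∀ i j, U j ⊓ V i ≠ ⊥ := fun i j => by rw [inf_comm]; exact hVU i j
  have hV01 := hVV _ _ h01
  have hU01 := hUU _ _ h01
  obtain ⟨x, ⟨hxV, hxU⟩, hx⟩ := Submodule.exists_mem_ne_zero_of_ne_bot (hVU i₂ i₂)
  obtain ⟨y, z, rfl, hyU, hyV, hzU, hzV⟩ :=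
    exists_add_of_mem (hU i₂) hV01 (hUV i₀ i₂) (hUV i₁ i₂) hxU
  obtain ⟨a, c, rfl, haV, haU, hcV, hcU⟩ :=
    exists_add_of_mem (hV i₀) hU01 (hVU i₀ i₀) (hVU i₀ i₁) hyV
  obtain ⟨b, d, rfl, hbV, hbU, hdV, hdU⟩ :=
    exists_add_of_mem (hV i₁) hU01 (hVU i₁ i₀) (hVU i₁ i₁) hzV
  obtain ⟨p, r, hpr, hpV, hpU, hrV, hrU⟩ :=
    exists_add_of_mem (hV i₂) hU01 (hVU i₂ i₀) (hVU i₂ i₁) hxV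
  obtain ⟨rfl, rfl⟩ := eq_and_eq_of_add_eq_add hU01 hpU hrU
    ((U i₀).add_mem haU hbU) ((U i₁).add_mem hcU hdU) (by rw [← hpr]; abel)
  have hy : a + c ≠ 0 := fun h => hx <| by
    rw [h, zero_add] at hxV ⊢
    exact Submodule.disjoint_def.1 (hVV _ _ h12) _ hzV hxV
  have hz : b + d ≠ 0 := fun h => hx <| by
    rw [h, add_zero] at hxV ⊢
    exact Submodule.disjoint_def.1 (hVV _ _ h02) _ hyV hxV
  have ha : a ≠ 0 := fun h => hy <| by
    rw [h, zero_add] at hyU ⊢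
    exact Submodule.disjoint_def.1 (hUU _ _ h12) _ hcU hyU
  have hc : c ≠ 0 := fun h => hy <| by
    rw [h, add_zero] at hyU ⊢
    exact Submodule.disjoint_def.1 (hUU _ _ h02) _ haU hyU
  have hb : b ≠ 0 := fun h => hz <| by
    rw [h, zero_add] at hzU ⊢
    exact Submodule.disjoint_def.1 (hUU _ _ h12) _ hdU hzU
  have hd : d ≠ 0 := fun h => hz <| by
    rw [h, add_zero] at hzU ⊢
    exact Submodule.disjoint_def.1 (hUU _ _ h02) _ hbU hzU
  have hzero : ∀ s t u v : K, s • a + t • b + u • c + v • d = 0 →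
      s = 0 ∧ t = 0 ∧ u = 0 ∧ v = 0 := fun s t u v h => by
    obtain ⟨h1, h2⟩ := eq_zero_of_add_eq_zero hV01
      ((V i₀).add_mem ((V i₀).smul_mem s haV) ((V i₀).smul_mem u hcV))
      ((V i₁).add_mem ((V i₁).smul_mem t hbV) ((V i₁).smul_mem v hdV)) (by rw [← h]; abel)
    obtain ⟨h3, h4⟩ := eq_zero_of_add_eq_zero hU01 ((U i₀).smul_mem s haU)
      ((U i₁).smul_mem u hcU) h1
    obtain ⟨h5, h6⟩ := eq_zero_of_add_eq_zero hU01 ((U i₀).smul_mem t hbU)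
      ((U i₁).smul_mem v hdU) h2
    simp_all
  have hac : LinearIndependent K ![a, c] := LinearIndependent.pair_iff.2 fun s u h =>
    have := hzero s 0 u 0 (by simpa using h)
    ⟨this.1, this.2.2.1⟩
  have hbd : LinearIndependent K ![b, d] := LinearIndependent.pair_iff.2 fun t v h =>
    have := hzero 0 t 0 v (by simpa using h)
    ⟨this.2.1, this.2.2.2⟩
  have hab : LinearIndependent K ![a, b] := LinearIndependent.pair_iff.2 fun s t h =>
    have := hzero s t 0 0 (by simpa using h)
    ⟨this.1, this.2.1⟩
  have hcd : LinearIndependent K ![c, d] := LinearIndependent.pair_iff.2 fun u v h =>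
    have := hzero 0 0 u v (by simpa using h)
    ⟨this.2.2.1, this.2.2.2⟩
  have hV₂ : V i₂ = Submodule.span K {a + b, c + d} :=
    eq_span_pair_of_disjoint (hV i₂) hU01 hpV hrV hpU hrU
      (fun h => ha (eq_zero_of_add_eq_zero hV01 haV hbV h).1)
      (fun h => hc (eq_zero_of_add_eq_zero hV01 hcV hdV h).1)
  have hU₂ : U i₂ = Submodule.span K {a + c, b + d} :=
    eq_span_pair_of_disjoint (hU i₂) hV01 hyU hzU hyV hzV hy hz
  have hnotMem : ∀ {T : ι → Submodule K X}, (∀ i j, i ≠ j → Disjoint (T i) (T j)) →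
      ∀ {e f : X}, e ∈ T i₀ → f ∈ T i₁ → e ≠ 0 → f ≠ 0 → ∀ i, e ∈ T i → f ∉ T i := by
    intro T hT e f he hf he0 hf0 i hei hfi
    by_cases hi : i = i₀
    · subst hi
      exact hf0 (Submodule.disjoint_def.1 (hT _ _ h01) _ hfi hf)
    · exact he0 (Submodule.disjoint_def.1 (hT _ _ hi) _ hei he)
  refine ⟨a, b, c, d, ?_, fun α β hαβ hne => ?_⟩
  · rw [Fintype.linearIndependent_iff]
    intro g hg
    have := hzero (g 0) (g 1) (g 2) (g 3) (by simpa [Fin.sum_univ_four] using hg)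
    intro i
    fin_cases i <;> simp [this]
  · obtain ⟨τ, hτ⟩ := exists_perm_eq_span hV01 haV hcV hbV hdV hac hbd hU (hUV i₀) (hUV i₁)
      (fun i => hV₂ ▸ hUV i₂ i) (hnotMem hUU haU hcU ha hc) (hVcover i₀) hαβ hne
    obtain ⟨σ, hσ⟩ := exists_perm_eq_span hU01 haU hbU hcU hdU hab hcd hV (hVU · i₀) (hVU · i₁)
      (fun i => hU₂ ▸ hVU i i₂) (hnotMem hVV haV hbV ha hb) (hUcover i₀) hαβ hne
    exact ⟨σ, τ, hσ, hτ⟩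

end Regulus

theorem exists_projective_line_enumeration (K : Type*) [Field K] [Fintype K] :
    ∃ α β : Fin (Fintype.card K + 1) → K, (∀ i, (α i, β i) ≠ 0) ∧
      ∀ i j, i ≠ j → α i * β j ≠ α j * β i := by
  obtain ⟨e⟩ : Nonempty (Fin (Fintype.card K + 1) ≃ Option K) :=
    ⟨Fintype.equivOfCardEq (by simp)⟩
  refine ⟨fun i => (e i).elim 0 fun _ => 1, fun i => (e i).elim 1 id, fun i => ?_,
    fun i j hij => ?_⟩
  · rcases h : e i with _ | x <;> simp [h]
  · have := e.injective.ne hij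
    rcases hi : e i with _ | x <;> rcases hj : e j with _ | y <;> rw [hi, hj] at this
    · exact absurd rfl this
    · simp [hi, hj]
    · simp [hi, hj]
    · simpa [hi, hj, eq_comm] using this

section Quotient

variable {K W : Type*} [Field K] [AddCommGroup W] [Module K W]

theorem finrank_map_mkQ_add_finrank [FiniteDimensional K W] {S V : Submodule K W} (h : S ≤ V) :
    Module.finrank K (V.map S.mkQ) + Module.finrank K S = Module.finrank K V := by
  have := LinearMap.finrank_range_add_finrank_ker (S.mkQ.domRestrict V)
  rw [LinearMap.range_domRestrict, LinearMap.ker_domRestrict, Submodule.ker_mkQ] at this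
  rw [← this, ← (Submodule.comapSubtypeEquivOfLe h).finrank_eq]

theorem mem_map_mkQ_iff {S V : Submodule K W} (h : S ≤ V) {w : W} :
    S.mkQ w ∈ V.map S.mkQ ↔ w ∈ V := by
  rw [← Submodule.mem_comap, Submodule.comap_map_mkQ, sup_eq_right.2 h]

theorem disjoint_map_mkQ {S V V' : Submodule K W} (h : S ≤ V) (h' : S ≤ V')
    (hd : V ⊓ V' ≤ S) : Disjoint (V.map S.mkQ) (V'.map S.mkQ) := by
  rw [Submodule.disjoint_def]
  intro x hx hx'
  obtain ⟨w, rfl⟩ := S.mkQ_surjective x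
  rw [mem_map_mkQ_iff h] at hx
  rw [mem_map_mkQ_iff h'] at hx'
  simpa using hd ⟨hx, hx'⟩

theorem map_mkQ_inf_map_mkQ_ne_bot {S V V' : Submodule K W} (h : S ≤ V) (h' : S ≤ V')
    (hd : ¬ V ⊓ V' ≤ S) : V.map S.mkQ ⊓ V'.map S.mkQ ≠ ⊥ := fun hbot => by
  refine hd fun w hw => ?_
  have : S.mkQ w ∈ V.map S.mkQ ⊓ V'.map S.mkQ :=
    ⟨(mem_map_mkQ_iff h).2 hw.1, (mem_map_mkQ_iff h').2 hw.2⟩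
  simpa [hbot] using this

theorem eq_sup_span_pair_of_map_mkQ_eq {S V : Submodule K W} (h : S ≤ V) {x y : W}
    (hV : V.map S.mkQ = Submodule.span K {S.mkQ x, S.mkQ y}) :
    V = S ⊔ Submodule.span K {x, y} := by
  rw [← Submodule.comap_map_mkQ, Submodule.map_span, Set.image_pair, ← hV,
    Submodule.comap_map_mkQ, sup_eq_right.2 h]

theorem inf_span_range_eq_bot_of_linearIndependent_mkQ {ι : Type*} {S : Submodule K W}
    {v : ι → W} (hv : LinearIndependent K (S.mkQ ∘ v)) :
    S ⊓ Submodule.span K (Set.range v) = ⊥ := by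
  have := Submodule.range_ker_disjoint hv
  rwa [Submodule.ker_mkQ, disjoint_iff, inf_comm] at this

end Quotient

theorem exists_mem_of_card_filter_eq {K W : Type*} [Field K] [AddCommGroup W]
    [Module K W] {m : ℕ} {U V : Fin m → Submodule K W} {w : W}
    (h : #{i | w ∈ V i} = #{i | w ∈ U i}) {i : Fin m} (hi : w ∈ V i) : ∃ j, w ∈ U j := by
  have : 0 < #{i | w ∈ V i} := card_pos.2 ⟨i, by simpa using hi⟩
  rw [h] at this
  obtain ⟨j, hj⟩ := card_pos.1 this
  exact ⟨j, by simpa using hj⟩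

theorem forall_mem_of_card_filter_eq {K W : Type*} [Field K] [AddCommGroup W]
    [Module K W] {m : ℕ} {U V : Fin m → Submodule K W} {w : W}
    (h : #{i | w ∈ V i} = #{i | w ∈ U i}) (hw : ∀ i, w ∈ V i) (j : Fin m) : w ∈ U j := by
  rw [filter_true_of_mem fun i _ => hw i, eq_comm, card_filter_eq_iff] at h
  exact h j (mem_univ j)

theorem IsometrySolution.card_filter_eq {K W : Type*} [Field K] [Fintype K] [AddCommGroup W]
    [Module K W] [FiniteDimensional K W] {m n : ℕ} {U V : Fin m → Submodule K W}
    (hsol : IsometrySolution U V)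
    (hdim : ∀ i, Module.finrank K ↥(V i) = n ∧ Module.finrank K ↥(U i) = n) (w : W) :
    #{i | w ∈ V i} = #{i | w ∈ U i} := by
  have h := hsol.countP_eq hdim w
  simp only [Multiset.countP_map] at h
  exact h

/-- If no `U j` lies in a `V i`, then a point in two of the spaces `V i` lies in every `U j`. -/
theorem mem_of_mem_inf_of_cover {K W : Type*} [Field K] [Fintype K] [AddCommGroup W]
    [Module K W] {U V : Fin (Fintype.card K + 1) → Submodule K W}
    (hcount : ∀ w, #{i | w ∈ V i} = #{i | w ∈ U i})
    (hUV : ∀ i j, ¬ U j ≤ V i) {i i' : Fin (Fintype.card K + 1)} (hii : i ≠ i') {w : W}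
    (hi : w ∈ V i) (hi' : w ∈ V i') (j : Fin (Fintype.card K + 1)) : w ∈ U j := by
  obtain ⟨k, hk⟩ := exists_mem_of_card_filter_eq (hcount w) hi
  refine forall_mem_of_card_filter_eq (hcount w) (fun l => ?_) j
  exact mem_of_mem_of_mem_of_cover (Fintype.card_fin _) V (U k)
    (fun w hw => exists_mem_of_card_filter_eq (hcount w).symm hw) (fun l => hUV l k) hii l hk
    hi hi'

theorem finrank_inf_inf_add_two {K W : Type*} [Field K] [AddCommGroup W] [Module K W]
    [FiniteDimensional K W] {n : ℕ} {V A B : Submodule K W}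
    (hV : Module.finrank K V = n) (hA : Module.finrank K ↥(V ⊓ A) + 1 = n)
    (hB : Module.finrank K ↥(V ⊓ B) + 1 = n) (hAB : ¬ V ⊓ A ≤ B) :
    Module.finrank K ↥(V ⊓ A ⊓ B) + 2 = n := by
  have h := Submodule.finrank_sup_add_finrank_inf_eq (V ⊓ A) (V ⊓ B)
  have hinf : V ⊓ A ⊓ (V ⊓ B) = V ⊓ A ⊓ B := by
    rw [← inf_inf_distrib_left, inf_assoc]
  have hle : Module.finrank K ↥(V ⊓ A ⊔ V ⊓ B) ≤ n :=
    hV ▸ Submodule.finrank_mono (sup_le inf_le_left inf_le_left)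
  have hlt : Module.finrank K ↥(V ⊓ B) < Module.finrank K ↥(V ⊓ A ⊔ V ⊓ B) :=
    Submodule.finrank_lt_finrank_of_lt (right_lt_sup.2 fun h => hAB (h.trans inf_le_right))
  rw [hinf] at h
  omega

/-- A nontrivial minimal solution in which all spaces have the same dimension `n > 1` is
equivalent to a pair of Type C. -/
theorem nontrivial_solution_is_typeC
    (K W : Type*) [Field K] [Fintype K] [AddCommGroup W] [Module K W]
    [FiniteDimensional K W]
    (U V : Fin (Fintype.card K + 1) → Submodule K W)
    (hsol : IsometrySolution U V) (hnontriv : ¬ TuplesEquiv U V)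
    (n : ℕ) (hn : 1 < n)
    (hdim : ∀ i, Module.finrank K ↥(V i) = n ∧ Module.finrank K ↥(U i) = n) :
    ∃ (σ τ : Equiv.Perm (Fin (Fintype.card K + 1))) (S : Submodule K W) (a b c d : W),
      LinearIndependent K ![a, b, c, d] ∧
      S ⊓ Submodule.span K {a, b, c, d} = ⊥ ∧
      ∃ α β : Fin (Fintype.card K + 1) → K,
        (∀ i, (α i, β i) ≠ 0) ∧
        (∀ i j, i ≠ j → α i * β j ≠ α j * β i) ∧
        (∀ i, V (σ i) = S ⊔ Submodule.span K {α i • a + β i • b, α i • c + β i • d}) ∧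
        (∀ i, U (τ i) = S ⊔ Submodule.span K {α i • a + β i • c, α i • b + β i • d}) := by
  have hcount := hsol.card_filter_eq hdim
  have hne := hsol.ne_of_not_tuplesEquiv hnontriv hdim
  have hVU : ∀ i j, ¬ V i ≤ U j := fun i j h =>
    hne i j (Submodule.eq_of_le_of_finrank_eq h ((hdim i).1.trans (hdim j).2.symm))
  have hUV : ∀ i j, ¬ U j ≤ V i := fun i j h =>
    hne i j (Submodule.eq_of_le_of_finrank_eq h ((hdim j).2.trans (hdim i).1.symm)).symm
  have hVcover : ∀ i, ∀ w ∈ V i, ∃ j, w ∈ U j := fun i w hw =>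
    exists_mem_of_card_filter_eq (hcount w) hw
  have hUcover : ∀ j, ∀ w ∈ U j, ∃ i, w ∈ V i := fun j w hw =>
    exists_mem_of_card_filter_eq (hcount w).symm hw
  obtain ⟨i₀, i₁, i₂, -, -, -, h01, h02, h12⟩ :=
    two_lt_card_iff.1 (show 2 < #(univ : Finset (Fin (Fintype.card K + 1))) by
      have := Fintype.one_lt_card (α := K)
      simp only [card_univ, Fintype.card_fin]
      omega)
  have hUS : ∀ w, (∀ j, w ∈ U j) → ∀ i, w ∈ V i := fun w hw =>
    forall_mem_of_card_filter_eq (hcount w).symm hw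
  let S : Submodule K W := ⨅ j, U j
  have hSU : ∀ j, S ≤ U j := iInf_le U
  have hSV : ∀ i, S ≤ V i := fun i w hw => hUS w (fun j => hSU j hw) i
  have hVV : ∀ i i', i ≠ i' → V i ⊓ V i' ≤ S := fun i i' h w hw =>
    (Submodule.mem_iInf U).2 (mem_of_mem_inf_of_cover hcount hUV h hw.1 hw.2)
  have hUU : ∀ j j', j ≠ j' → U j ⊓ U j' ≤ S := fun j j' h w hw =>
    (Submodule.mem_iInf U).2 (forall_mem_of_card_filter_eq (hcount w)
      (mem_of_mem_inf_of_cover (fun w => (hcount w).symm) (fun j i => hVU i j) h hw.1 hw.2))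
  have hfin : ∀ i j, Module.finrank K ↥(V i ⊓ U j) + 1 = n := fun i j =>
    (finrank_inf_of_cover (Fintype.card_fin _) U (V i) (hVcover i) (hVU i) j).trans (hdim i).1
  have hS : Module.finrank K S + 2 = n := by
    have hVUU : V i₀ ⊓ U i₀ ⊓ U i₁ = S := le_antisymm
      (fun w hw => hUU _ _ h01 ⟨hw.1.2, hw.2⟩) (le_inf (le_inf (hSV _) (hSU _)) (hSU _))
    rw [← hVUU]
    refine finrank_inf_inf_add_two (hdim i₀).1 (hfin _ _) (hfin _ _) fun h => ?_
    obtain ⟨v, hv, hvU, H⟩ :=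
      exists_line_meets_of_cover (Fintype.card_fin _) U (V i₀) (hVcover i₀) (hVU i₀) i₀
    obtain ⟨j, hj⟩ := hVcover i₀ v hv
    obtain rfl : j = i₀ := by_contra fun hji => hvU j hji hj
    exact hvU i₁ h01.symm (h ⟨hv, hj⟩)
  have hnot : ∀ i j, ¬ V i ⊓ U j ≤ S := fun i j h => by
    have := Submodule.finrank_mono h
    have := hfin i j
    omega
  obtain ⟨α, β, hαβ, hαβne⟩ := exists_projective_line_enumeration K
  obtain ⟨a, b, c, d, hli, H⟩ := exists_regulus_basis (U := fun j => (U j).map S.mkQ)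
    (V := fun i => (V i).map S.mkQ) h01 h02 h12
    (fun i => by have := finrank_map_mkQ_add_finrank (hSV i); rw [(hdim i).1] at this; omega)
    (fun i => by have := finrank_map_mkQ_add_finrank (hSU i); rw [(hdim i).2] at this; omega)
    (fun i j h => disjoint_map_mkQ (hSV i) (hSV j) (hVV i j h))
    (fun i j h => disjoint_map_mkQ (hSU i) (hSU j) (hUU i j h))
    (fun i j => map_mkQ_inf_map_mkQ_ne_bot (hSV i) (hSU j) (hnot i j))
    (by
      rintro i _ ⟨w, hw, rfl⟩
      exact (hVcover i w hw).imp fun j hj => Submodule.mem_map_of_mem hj)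
    (by
      rintro j _ ⟨w, hw, rfl⟩
      exact (hUcover j w hw).imp fun i hi => Submodule.mem_map_of_mem hi)
  obtain ⟨σ, τ, hσ, hτ⟩ := H α β hαβ hαβne
  obtain ⟨a, rfl⟩ := S.mkQ_surjective a
  obtain ⟨b, rfl⟩ := S.mkQ_surjective b
  obtain ⟨c, rfl⟩ := S.mkQ_surjective c
  obtain ⟨d, rfl⟩ := S.mkQ_surjective d
  have hli' : LinearIndependent K (S.mkQ ∘ ![a, b, c, d]) := by
    rwa [show S.mkQ ∘ ![a, b, c, d] = ![S.mkQ a, S.mkQ b, S.mkQ c, S.mkQ d] by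
      ext i
      fin_cases i <;> rfl]
  refine ⟨σ, τ, S, a, b, c, d, hli'.of_comp, ?_, α, β, hαβ, hαβne, fun i => ?_, fun i => ?_⟩
  · have hrange : ({a, b, c, d} : Set W) = Set.range ![a, b, c, d] := by
      ext x
      simp only [Set.mem_insert_iff, Set.mem_singleton_iff, Set.mem_range, Fin.exists_fin_succ]
      simp [eq_comm]
    rw [hrange]
    exact inf_span_range_eq_bot_of_linearIndependent_mkQ hli'
  · exact eq_sup_span_pair_of_map_mkQ_eq (hSV _) (by simpa only [map_add, map_smul] using hσ i)
  · exact eq_sup_span_pair_of_map_mkQ_eq (hSU _) (by simpa only [map_add, map_smul] using hτ i)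
end

section
/- Let K be a finite field with |K| = q, let W be a finite-dimensional K-vector space, and let (U,V) be a nontrivial solution of the isometry equation with tuples of length m = q+1. Then, up to equivalence of pairs, (U,V) is of Type A, Type B, or Type C: that is, there exist permutations of the tuples and possibly a swap of the roles of U and V after which either (A) there are a subspace S and linearly independent a, b ∈ W with S ∩ span{a,b} = {0} such that V_1 = ⋯ = V_q = S + span{a,b}, V_{q+1} = S, and the U_i are the q+1 spaces S + span{α a + β b} for [α : β] ranging over the projective line over K; or (B) there are a subspace S, linearly independent a, b, c ∈ W with S ∩ span{a,b,c} = {0}, and an enumeration α_1,…,α_q of K such that V_m = S + span{a}, V_i = S + span{b, α_i a + c}, U_m = S + span{b}, U_i = S + span{a, α_i b + c} for i ∈ {1,…,q}; or (C) there are a subspace S, linearly independent a, b, c, d ∈ W with S ∩ span{a,b,c,d} = {0}, and an enumeration [α_i : β_i] of the q+1 points of the projective line over K such that V_i = S + span{α_i a + β_i b, α_i c + β_i d} and U_i = S + span{α_i a + β_i c, α_i b + β_i d} for all i ∈ {1,…,m}. -/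
open Finset
open scoped Classical

/-- A pair of tuples of length `|K| + 1` is of Type A. -/
def IsTypeA {K W : Type*} [Field K] [Fintype K] [AddCommGroup W] [Module K W]
    (U V : Fin (Fintype.card K + 1) → Submodule K W) : Prop :=
  ∃ (S : Submodule K W) (a b : W),
    LinearIndependent K ![a, b] ∧ S ⊓ Submodule.span K {a, b} = ⊥ ∧
    (∀ i, i ≠ Fin.last (Fintype.card K) → V i = S ⊔ Submodule.span K {a, b}) ∧
    V (Fin.last (Fintype.card K)) = S ∧
    ∃ α β : Fin (Fintype.card K + 1) → K,
      (∀ i, (α i, β i) ≠ 0) ∧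
      (∀ i j, i ≠ j → α i * β j ≠ α j * β i) ∧
      ∀ i, U i = S ⊔ Submodule.span K {α i • a + β i • b}

/-- A pair of tuples of length `|K| + 1` is of Type B. -/
def IsTypeB {K W : Type*} [Field K] [Fintype K] [AddCommGroup W] [Module K W]
    (U V : Fin (Fintype.card K + 1) → Submodule K W) : Prop :=
  ∃ (S : Submodule K W) (a b c : W),
    LinearIndependent K ![a, b, c] ∧ S ⊓ Submodule.span K {a, b, c} = ⊥ ∧
    ∃ α : Fin (Fintype.card K) → K, Function.Bijective α ∧
      V (Fin.last (Fintype.card K)) = S ⊔ Submodule.span K {a} ∧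
      (∀ i : Fin (Fintype.card K),
        V i.castSucc = S ⊔ Submodule.span K {b, α i • a + c}) ∧
      U (Fin.last (Fintype.card K)) = S ⊔ Submodule.span K {b} ∧
      (∀ i : Fin (Fintype.card K),
        U i.castSucc = S ⊔ Submodule.span K {a, α i • b + c})

/-- A pair of tuples of length `|K| + 1` is of Type C. -/
def IsTypeC {K W : Type*} [Field K] [Fintype K] [AddCommGroup W] [Module K W]
    (U V : Fin (Fintype.card K + 1) → Submodule K W) : Prop :=
  ∃ (S : Submodule K W) (a b c d : W),
    LinearIndependent K ![a, b, c, d] ∧ S ⊓ Submodule.span K {a, b, c, d} = ⊥ ∧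
    ∃ α β : Fin (Fintype.card K + 1) → K,
      (∀ i, (α i, β i) ≠ 0) ∧
      (∀ i j, i ≠ j → α i * β j ≠ α j * β i) ∧
      (∀ i, V i = S ⊔ Submodule.span K {α i • a + β i • b, α i • c + β i • d}) ∧
      (∀ i, U i = S ⊔ Submodule.span K {α i • a + β i • c, α i • b + β i • d})


section Covering

variable {K D ι : Type*} [Field K] [Fintype K] [AddCommGroup D] [Module K D]

omit [Fintype K] in
lemma Submodule.eq_of_add_smul_mem {H : Submodule K D} {x y : D} {s t : K} (hx : x ∉ H)
    (hs : y + s • x ∈ H) (ht : y + t • x ∈ H) : s = t := by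
  by_contra hst
  have h : (s - t) • x ∈ H := by
    have := H.sub_mem hs ht
    rwa [add_sub_add_left_eq_sub, ← sub_smul] at this
  exact hx ((H.smul_mem_iff (sub_ne_zero.2 hst)).1 h)

/-- A subspace is not covered by `|K|` or fewer subspaces that do not contain it. -/
lemma Submodule.exists_mem_forall_notMem (X : Submodule K D) (H : ι → Submodule K D)
    (s : Finset ι) (hs : s.card ≤ Fintype.card K) (h : ∀ j ∈ s, ¬ X ≤ H j) :
    ∃ x ∈ X, ∀ j ∈ s, x ∉ H j := by
  induction s using Finset.induction_on with
  | empty => exact ⟨0, X.zero_mem, by simp⟩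
  | insert j s hj ih =>
    rw [Finset.card_insert_of_notMem hj] at hs
    obtain ⟨x, hxX, hx⟩ := ih (by omega) fun k hk => h k (Finset.mem_insert_of_mem hk)
    by_cases hxj : x ∈ H j
    · obtain ⟨y, hyX, hy⟩ := SetLike.not_le_iff_exists.1 (h j (Finset.mem_insert_self j s))
      by_contra! hcon
      have hcov : ∀ t : K, ∃ k ∈ s, y + t • x ∈ H k := fun t => by
        obtain ⟨k, hk, hmem⟩ := hcon _ (X.add_mem hyX (X.smul_mem t hxX))
        rcases Finset.mem_insert.1 hk with rfl | hk
        · exact absurd (((H k).add_mem_iff_left ((H k).smul_mem t hxj)).1 hmem) hy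
        · exact ⟨k, hk, hmem⟩
      choose g hgs hg using hcov
      have := Finset.card_le_card_of_injOn (s := (Finset.univ : Finset K)) g
        (fun t _ => hgs t)
        (fun t _ t' _ htt => eq_of_add_smul_mem (hx _ (hgs t)) (hg t) (htt ▸ hg t'))
      rw [Finset.card_univ] at this
      omega
    · exact ⟨x, hxX, fun k hk => by
        rcases Finset.mem_insert.1 hk with rfl | hk
        exacts [hxj, hx k hk]⟩

variable [Fintype ι]

/-- In a covering of a subspace by `|K| + 1` subspaces not containing it, the lines in a fixed
direction belonging to one member only meet each other member exactly once. -/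
lemma Submodule.exists_bijOn_of_cover (hι : Fintype.card ι = Fintype.card K + 1)
    {X : Submodule K D} {H : ι → Submodule K D} (hX : ∀ x ∈ X, ∃ j, x ∈ H j) {k : ι} {x y : D}
    (hxX : x ∈ X) (hxk : x ∈ H k) (hx : ∀ j ≠ k, x ∉ H j) (hyX : y ∈ X) (hy : y ∉ H k) :
    ∃ g : K → ι, (∀ t, y + t • x ∈ H (g t)) ∧ ∀ j ≠ k, ∃ t, g t = j := by
  choose g hg using fun t : K => hX _ (X.add_mem hyX (X.smul_mem t hxX))
  have hgk : ∀ t, g t ≠ k := fun t htk =>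
    hy (((H k).add_mem_iff_left ((H k).smul_mem t hxk)).1 (htk ▸ hg t))
  have hinj : Function.Injective g := fun t t' htt =>
    eq_of_add_smul_mem (hx _ (hgk t)) (hg t) (htt ▸ hg t')
  refine ⟨g, hg, fun j hj => ?_⟩
  have himg : Finset.univ.image g = Finset.univ.erase k := by
    apply Finset.eq_of_subset_of_card_le
    · intro j hj
      obtain ⟨t, -, rfl⟩ := Finset.mem_image.1 hj
      simpa using hgk t
    · rw [Finset.card_image_of_injective _ hinj, Finset.card_erase_of_mem (Finset.mem_univ k)]
      simp [hι]
  have : j ∈ Finset.univ.image g := by rw [himg]; simpa using hj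
  simpa using this

end Covering

section Counting

variable {K D ι : Type*} [Field K] [Fintype K] [AddCommGroup D] [Module K D] [Fintype ι]

/-- The subspace `A i` is cut by the subspaces `B j` into distinct lines through the origin, any two
of which span `A i`, and it meets the other subspaces `A k` trivially. -/
structure IsTransversal (A B : ι → Submodule K D) (i : ι) : Prop where
  not_le : ∀ j, ¬ A i ≤ B j
  exists_mem_of_mem : ∀ x ∈ A i, ∃ j, x ∈ B j
  exists_span : ∀ j, ∃ x ≠ 0, A i ⊓ B j = Submodule.span K {x}
  sup_eq : ∀ j k, j ≠ k → (A i ⊓ B j) ⊔ (A i ⊓ B k) = A i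
  eq_zero : ∀ j k, j ≠ k → ∀ x ∈ A i, x ∈ B j → x ∈ B k → x = 0
  eq_zero' : ∀ k, i ≠ k → ∀ x ∈ A i, x ∈ A k → x = 0

lemma isTransversal_of_not_le (hι : Fintype.card ι = Fintype.card K + 1)
    {A B : ι → Submodule K D}
    (hcount : ∀ x, #{i | x ∈ A i} = #{i | x ∈ B i})
    (hbot : ∀ x, (∀ i, x ∈ A i) → (∀ i, x ∈ B i) → x = 0)
    {i : ι} (hi : ∀ j, ¬ A i ≤ B j) : IsTransversal A B i := by
  have hcover : ∀ x ∈ A i, ∃ j, x ∈ B j := fun x hx => by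
    have h : 0 < #{i | x ∈ B i} := hcount x ▸ Finset.card_pos.2 ⟨i, by simpa using hx⟩
    obtain ⟨j, hj⟩ := Finset.card_pos.1 h
    exact ⟨j, by simpa using hj⟩
  have hw : ∀ j, ∃ x ∈ A i, x ∈ B j ∧ ∀ k ≠ j, x ∉ B k := fun j => by
    obtain ⟨x, hxA, hx⟩ := Submodule.exists_mem_forall_notMem (A i) B (Finset.univ.erase j)
      (by rw [Finset.card_erase_of_mem (Finset.mem_univ j)]; simp [hι]) (fun k _ => hi k)
    obtain ⟨k, hk⟩ := hcover x hxA
    have hkj : k = j := by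
      by_contra hkj
      exact hx k (by simpa using hkj) hk
    exact ⟨x, hxA, hkj ▸ hk, fun l hl => hx l (by simpa using hl)⟩
  choose x hxA hxB hx using hw
  have hall : ∀ y ∈ A i, (∀ j, y ∈ B j) → y = 0 := fun y _ hB => by
    refine hbot y (fun k => ?_) hB
    have h : #{i | y ∈ A i} = #(univ : Finset ι) := by
      rw [hcount, Finset.filter_true_of_mem fun j _ => hB j]
    have := Finset.eq_of_subset_of_card_le (Finset.filter_subset _ _) h.ge
    simpa using this.ge (Finset.mem_univ k)
  have hzero : ∀ j k, j ≠ k → ∀ y ∈ A i, y ∈ B j → y ∈ B k → y = 0 := by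
    intro j k hjk y hyA hyj hyk
    refine hall y hyA fun l => ?_
    by_contra hyl
    obtain ⟨g, hg, hgs⟩ := Submodule.exists_bijOn_of_cover hι hcover (hxA l) (hxB l) (hx l) hyA hyl
    have key : ∀ m, y ∈ B m → g 0 = m := fun m hm => by
      have hml : m ≠ l := fun h => hyl (h ▸ hm)
      obtain ⟨t, rfl⟩ := hgs m hml
      rw [Submodule.eq_of_add_smul_mem (s := 0) (t := t) (hx l _ hml) (by simpa using hm) (hg t)]
    exact hjk ((key j hyj).symm.trans (key k hyk))
  have hne : ∀ j, ∃ k, k ≠ j := fun j =>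
    Fintype.exists_ne_of_one_lt_card (by have := Fintype.card_pos (α := K); rw [hι]; omega) j
  have hmeet : ∀ j k, j ≠ k → ∀ y ∈ A i, ∃ t : K, y + t • x k ∈ B j := by
    intro j k hjk y hyA
    by_cases hyk : y ∈ B k
    · have h : y + x j ∉ B k := fun h => hx j k hjk.symm (((B k).add_mem_iff_right hyk).1 h)
      obtain ⟨g, hg, hgs⟩ := Submodule.exists_bijOn_of_cover hι hcover (hxA k) (hxB k) (hx k)
        ((A i).add_mem hyA (hxA j)) h
      obtain ⟨t, rfl⟩ := hgs j hjk
      refine ⟨t, ((B (g t)).add_mem_iff_left (hxB (g t))).1 ?_⟩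
      rw [add_right_comm]
      exact hg t
    · obtain ⟨g, hg, hgs⟩ := Submodule.exists_bijOn_of_cover hι hcover (hxA k) (hxB k) (hx k)
        hyA hyk
      obtain ⟨t, rfl⟩ := hgs j hjk
      exact ⟨t, hg t⟩
  refine ⟨hi, hcover, fun j => ⟨x j, ?_, ?_⟩, fun j k hjk => ?_, hzero, fun k hik y hyi hyk => ?_⟩
  · obtain ⟨k, hk⟩ := hne j
    exact fun h => hx j k hk (h ▸ (B k).zero_mem)
  · apply le_antisymm
    · rintro y ⟨hyA, hyB⟩
      obtain ⟨k, hk⟩ := hne j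
      obtain ⟨t, ht⟩ := hmeet k j hk y hyA
      have h0 := hzero j k hk.symm _ ((A i).add_mem hyA ((A i).smul_mem t (hxA j)))
        ((B j).add_mem hyB ((B j).smul_mem t (hxB j))) ht
      exact Submodule.mem_span_singleton.2 ⟨-t, by
        rw [neg_smul]; exact (eq_neg_of_add_eq_zero_left h0).symm⟩
    · rw [Submodule.span_singleton_le_iff_mem]
      exact ⟨hxA j, hxB j⟩
  · refine le_antisymm (sup_le inf_le_left inf_le_left) fun y hyA => ?_
    obtain ⟨t, ht⟩ := hmeet j k hjk y hyA
    refine Submodule.mem_sup.2 ⟨y + t • x k, ⟨(A i).add_mem hyA ((A i).smul_mem t (hxA k)), ht⟩,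
      -(t • x k), ⟨(A i).neg_mem ((A i).smul_mem t (hxA k)),
        (B k).neg_mem ((B k).smul_mem t (hxB k))⟩, by simp⟩
  · have h : 1 < #{i | y ∈ B i} := by
      rw [← hcount]
      exact Finset.one_lt_card.2 ⟨i, by simpa using hyi, k, by simpa using hyk, hik⟩
    obtain ⟨j, hj, k, hk, hjk⟩ := Finset.one_lt_card.1 h
    exact hzero j k hjk y hyi (by simpa using hj) (by simpa using hk)

/-- If two tuples of `|K| + 1` subspaces cover every point equally often, but are not permutations
of each other, then some subspace of one tuple is contained in no subspace of the other. -/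
lemma exists_forall_not_le [FiniteDimensional K D] (hι : Fintype.card ι = Fintype.card K + 1)
    {A B : ι → Submodule K D}
    (hcount : ∀ x, #{i | x ∈ A i} = #{i | x ∈ B i})
    (hne : ¬ ∃ σ : Equiv.Perm ι, ∀ i, A i = B (σ i)) :
    (∃ i, ∀ j, ¬ A i ≤ B j) ∨ ∃ j, ∀ i, ¬ B j ≤ A i := by
  have hex : ∃ X, #{i | A i = X} ≠ #{i | B i = X} := by
    by_contra! h
    apply hne
    have hcard : ∀ X, Fintype.card {i // A i = X} = Fintype.card {i // B i = X} := fun X => by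
      rw [Fintype.card_subtype, Fintype.card_subtype, h X]
    exact ⟨Equiv.ofFiberEquiv fun X => Fintype.equivOfCardEq (hcard X),
      fun i => (Equiv.ofFiberEquiv_map _ i).symm⟩
  obtain ⟨X, hX, hmax⟩ := (wellFounded_gt (α := Submodule K D)).has_min
    {X | #{i | A i = X} ≠ #{i | B i = X}} hex
  have main : ∀ A B : ι → Submodule K D, (∀ x, #{i | x ∈ A i} = #{i | x ∈ B i}) →
      (∀ Z, X < Z → #{i | A i = Z} = #{i | B i = Z}) → #{i | B i = X} < #{i | A i = X} →
      ∃ i, ∀ j, ¬ A i ≤ B j := by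
    intro A B hcount hgt hlt
    obtain ⟨i, hi⟩ := Finset.card_pos.1 (Nat.zero_lt_of_lt hlt)
    obtain rfl : A i = X := by simpa using hi
    set X := A i
    have hsplit : ∀ F : ι → Submodule K D, #{k | X ≤ F k} = #{k | F k = X} + #{k | X < F k} := by
      intro F
      rw [← Finset.card_union_of_disjoint]
      · congr 1
        ext k
        simp [le_iff_eq_or_lt, eq_comm]
      · rw [Finset.disjoint_filter]
        exact fun k _ h h' => h'.ne h.symm
    have hab : #{k | X < A k} = #{k | X < B k} := by
      have hfib : ∀ F : ι → Submodule K D, (∀ k, F k ∈ univ.image A ∪ univ.image B) →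
          #{k | X < F k} = ∑ Z ∈ (univ.image A ∪ univ.image B) with X < Z, #{k | F k = Z} := by
        intro F hF
        rw [Finset.card_eq_sum_card_fiberwise (f := F)
          (t := (univ.image A ∪ univ.image B).filter (X < ·))]
        · refine Finset.sum_congr rfl fun Z hZ => congrArg _ ?_
          ext k
          simp only [Finset.mem_filter, Finset.mem_univ, true_and] at hZ ⊢
          exact ⟨fun h => h.2, fun h => ⟨h ▸ hZ.2, h⟩⟩
        · intro k hk
          have hk' : X < F k := by simpa using hk
          exact Finset.mem_coe.2 (Finset.mem_filter.2 ⟨hF k, hk'⟩)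
      rw [hfib A (by simp), hfib B (by simp)]
      exact Finset.sum_congr rfl fun Z hZ => hgt Z (Finset.mem_filter.1 hZ).2
    have hltle : #{k | X ≤ B k} < #{k | X ≤ A k} := by
      rw [hsplit, hsplit, hab]
      omega
    refine ⟨i, fun j hj => ?_⟩
    obtain ⟨x, hxX, hx⟩ := Submodule.exists_mem_forall_notMem X B {k | ¬ X ≤ B k} (by
      have : #{k | ¬ X ≤ B k} < #(univ : Finset ι) := Finset.card_lt_card
        (Finset.filter_ssubset.2 ⟨j, Finset.mem_univ j, by simpa using hj⟩)
      rw [Finset.card_univ] at this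
      omega) (by simp)
    have hA : #{k | X ≤ A k} ≤ #{k | x ∈ A k} :=
      Finset.card_le_card (Finset.monotone_filter_right _ fun k _ h => h hxX)
    have hB : #{k | x ∈ B k} ≤ #{k | X ≤ B k} :=
      Finset.card_le_card (Finset.monotone_filter_right _ fun k _ h => by
        by_contra hk
        exact hx k (by simpa using hk) h)
    have := hcount x
    omega
  have hgt : ∀ Z, X < Z → #{i | A i = Z} = #{i | B i = Z} := fun Z hZ => by
    by_contra h
    exact hmax Z h hZ
  rcases lt_or_gt_of_ne hX with h | h
  · exact Or.inr (main B A (fun x => (hcount x).symm) (fun Z hZ => (hgt Z hZ).symm) h)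
  · exact Or.inl (main A B hcount hgt h)

end Counting

section Dual

variable {K D ι : Type*} [Field K] [AddCommGroup D] [Module K D]

lemma Submodule.eq_span_singleton_of_mem {X : Submodule K D} {x u : D}
    (hX : X = Submodule.span K {x}) (hu : u ∈ X) (h0 : u ≠ 0) : X = Submodule.span K {u} := by
  subst hX
  obtain ⟨r, rfl⟩ := Submodule.mem_span_singleton.1 hu
  exact (Submodule.span_singleton_smul_eq (IsUnit.mk0 r fun h => h0 (by simp [h])) x).symm

namespace IsTransversal

variable {A B : ι → Submodule K D} {i j k : ι}

lemma exists_mem (h : IsTransversal A B i) (j : ι) : ∃ x ≠ 0, x ∈ A i ∧ x ∈ B j := by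
  obtain ⟨x, hx0, hx⟩ := h.exists_span j
  have hxm : x ∈ A i ⊓ B j := hx ▸ Submodule.mem_span_singleton_self x
  exact ⟨x, hx0, hxm⟩

lemma le_of_le (h : IsTransversal A B i) {l : ι} (hl : B j ≤ A l) : B j ≤ A i := by
  by_cases hil : i = l
  · rwa [hil]
  · obtain ⟨x, hx0, hxA, hxB⟩ := h.exists_mem j
    exact absurd (h.eq_zero' l hil x hxA (hl hxB)) hx0

lemma inf_eq_span (h : IsTransversal A B i) {u : D} (hu : u ∈ A i) (huj : u ∈ B j)
    (h0 : u ≠ 0) : A i ⊓ B j = Submodule.span K {u} := by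
  obtain ⟨x, -, hx⟩ := h.exists_span j
  exact Submodule.eq_span_singleton_of_mem hx ⟨hu, huj⟩ h0

lemma eq_span_pair (h : IsTransversal A B i) (hjk : j ≠ k) {u v : D} (hu : u ∈ A i)
    (huj : u ∈ B j) (hu0 : u ≠ 0) (hv : v ∈ A i) (hvk : v ∈ B k) (hv0 : v ≠ 0) :
    A i = Submodule.span K {u, v} := by
  rw [← h.sup_eq j k hjk, h.inf_eq_span hu huj hu0, h.inf_eq_span hv hvk hv0,
    Submodule.span_insert]

lemma eq_span_pair_of_add_mem (h : IsTransversal A B i) (hjk : j ≠ k)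
    (hB : ∀ x ∈ B j, x ∈ B k → x = 0) {u v : D} (huj : u ∈ B j) (hu0 : u ≠ 0) (hvk : v ∈ B k)
    (hv0 : v ≠ 0) (huv : u + v ∈ A i) : A i = Submodule.span K {u, v} := by
  have huv' := huv
  rw [← h.sup_eq j k hjk] at huv'
  obtain ⟨u', hu', v', hv', he⟩ := Submodule.mem_sup.1 huv'
  have h1 : u' - u = v - v' := by
    rw [sub_eq_sub_iff_add_eq_add, he, add_comm]
  have h2 : u' - u = 0 := hB _ ((B j).sub_mem hu'.2 huj) (h1 ▸ (B k).sub_mem hvk hv'.2)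
  obtain rfl := sub_eq_zero.1 h2
  obtain rfl : v' = v := add_left_cancel he
  exact h.eq_span_pair hjk hu'.1 huj hu0 hv'.1 hvk hv0

end IsTransversal

lemma eq_zero_of_smul_add_smul_eq_zero {P Q : Submodule K D} (hPQ : ∀ x ∈ P, x ∈ Q → x = 0)
    {u v : D} (hu : u ∈ P) (hu0 : u ≠ 0) (hv : v ∈ Q) (hv0 : v ≠ 0) {s t : K}
    (h : s • u + t • v = 0) : s = 0 ∧ t = 0 := by
  have hs : s • u = 0 := hPQ _ (P.smul_mem s hu) (by
    rw [eq_neg_of_add_eq_zero_left h]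
    exact Q.neg_mem (Q.smul_mem t hv))
  rw [hs, zero_add] at h
  exact ⟨(smul_eq_zero.1 hs).resolve_right hu0, (smul_eq_zero.1 h).resolve_right hv0⟩

variable {A B : ι → Submodule K D} {i₀ j₀ : ι}

/-- If some member of `A` lies in a member of `B`, then at most one member of `B` lies in no member
of `A`. -/
lemma IsTransversal.eq_of_le (hB : IsTransversal B A j₀) {i : ι} (hi : ∃ j, A i ≤ B j) {j : ι}
    (hj : IsTransversal B A j) : j = j₀ := by
  obtain ⟨l, hl⟩ := hi
  by_contra hjj
  obtain ⟨x, hx0, hxB, hxA⟩ := hB.exists_mem i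
  exact hx0 (hB.eq_zero' j (Ne.symm hjj) x hxB (hj.le_of_le hl hxA))

variable [Fintype K] [Fintype ι]

/-- The configuration in which only one tuple has a member not contained in the other tuple. -/
lemma exists_points_of_forall_le (hι : Fintype.card ι = Fintype.card K + 1)
    (hcount : ∀ x, #{i | x ∈ A i} = #{i | x ∈ B i}) (h : IsTransversal A B i₀)
    (hB : ∀ j, ∃ i, B j ≤ A i) :
    ∃ f g : D, LinearIndependent K ![f, g] ∧ A i₀ = Submodule.span K {f, g} ∧
      (∀ i ≠ i₀, A i = ⊥) ∧ ∃ α β : ι → K, (∀ i, (α i, β i) ≠ 0) ∧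
        (∀ i j, i ≠ j → α i * β j ≠ α j * β i) ∧
        ∀ i, B i = Submodule.span K {α i • f + β i • g} := by
  have hle : ∀ j, B j ≤ A i₀ := fun j => by
    obtain ⟨i, hi⟩ := hB j
    exact h.le_of_le hi
  choose x hx0 hx using h.exists_span
  have hxB : ∀ j, B j = Submodule.span K {x j} := fun j => by
    rw [← hx j, inf_eq_right.2 (hle j)]
  have hxm : ∀ j, x j ∈ B j := fun j => hxB j ▸ Submodule.mem_span_singleton_self _
  have hdisj : ∀ j k, j ≠ k → ∀ y ∈ B j, y ∈ B k → y = 0 := fun j k hjk y hyj hyk =>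
    h.eq_zero j k hjk y (hle j hyj) hyj hyk
  obtain ⟨j, k, hjk⟩ := Fintype.exists_pair_of_one_lt_card
    (show 1 < Fintype.card ι by have := Fintype.card_pos (α := K); omega)
  have hspan := h.eq_span_pair hjk (hle j (hxm j)) (hxm j) (hx0 j) (hle k (hxm k)) (hxm k) (hx0 k)
  have hli : ∀ i l, i ≠ l → ∀ s t : K, s • x i + t • x l = 0 → s = 0 ∧ t = 0 :=
    fun i l hil s t => eq_zero_of_smul_add_smul_eq_zero (hdisj i l hil) (hxm i) (hx0 i) (hxm l)
      (hx0 l)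
  have hcoord : ∀ i, ∃ α β : K, α • x j + β • x k = x i := fun i =>
    Submodule.mem_span_pair.1 (hspan ▸ hle i (hxm i))
  choose α β hαβ using hcoord
  refine ⟨x j, x k, LinearIndependent.pair_iff.2 (hli j k hjk), hspan, fun i hi => ?_, α, β,
    fun i h0 => hx0 i ?_, fun i l hil he => ?_, fun i => by rw [hαβ, hxB]⟩
  · refine (Submodule.eq_bot_iff _).2 fun y hy => ?_
    have hpos : 0 < #{i | y ∈ B i} := hcount y ▸ Finset.card_pos.2 ⟨i, by simpa using hy⟩
    obtain ⟨l, hl⟩ := Finset.card_pos.1 hpos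
    exact h.eq_zero' i hi.symm y (hle l (by simpa using hl)) hy
  · obtain ⟨h1, h2⟩ := Prod.mk.inj h0
    rw [← hαβ i, h1, h2, zero_smul, zero_smul, add_zero]
  · have h1 := hli i l hil (β l) (-β i) (by
      rw [← hαβ i, ← hαβ l]
      linear_combination (norm := module) he • x j)
    have h2 := hli i l hil (α l) (-α i) (by
      rw [← hαβ i, ← hαβ l]
      linear_combination (norm := module) -(he • x k))
    apply hx0 l
    rw [← hαβ l, h1.1, h2.1, zero_smul, zero_smul, add_zero]

/-- The configuration of two intersecting planes, each with lines through the origin in the other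
plane. -/
lemma exists_lines_of_le (hι : Fintype.card ι = Fintype.card K + 1)
    (hA : IsTransversal A B i₀) (hB : IsTransversal B A j₀)
    (hA' : ∀ i ≠ i₀, ∃ j, A i ≤ B j) (hB' : ∀ j ≠ j₀, ∃ i, B j ≤ A i) :
    ∃ a b c : D, LinearIndependent K ![a, b, c] ∧
      A i₀ = Submodule.span K {b, c} ∧ B j₀ = Submodule.span K {a, c} ∧
      (∀ t : K, ∃ i ≠ i₀, A i = Submodule.span K {a - t • c}) ∧
      ∀ t : K, ∃ j ≠ j₀, B j = Submodule.span K {b - t • c} := by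
  have main : ∀ {A B : ι → Submodule K D} {i₀ j₀ : ι}, IsTransversal A B i₀ →
      (∀ j ≠ j₀, ∃ i, B j ≤ A i) → ∀ c ∈ A i₀, c ∈ B j₀ → c ≠ 0 →
      ∃ b ∈ A i₀, (∀ s t : K, s • b + t • c = 0 → s = 0 ∧ t = 0) ∧
        A i₀ = Submodule.span K {b, c} ∧ (∃ j ≠ j₀, b ∈ B j) ∧
        ∀ t : K, ∃ j ≠ j₀, B j = Submodule.span K {b - t • c} := by
    intro A B i₀ j₀ hA hB' c hcA hcB hc0
    obtain ⟨k, hk⟩ := Fintype.exists_ne_of_one_lt_card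
      (show 1 < Fintype.card ι by have := Fintype.card_pos (α := K); omega) j₀
    obtain ⟨b, hb0, hbA, hbB⟩ := hA.exists_mem k
    have hli : ∀ s t : K, s • b + t • c = 0 → s = 0 ∧ t = 0 := fun s t =>
      eq_zero_of_smul_add_smul_eq_zero (P := A i₀ ⊓ B k) (Q := B j₀)
        (fun x hx hx' => hA.eq_zero k j₀ hk x hx.1 hx.2 hx') ⟨hbA, hbB⟩ hb0 hcB hc0
    refine ⟨b, hbA, hli, hA.eq_span_pair hk hbA hbB hb0 hcA hcB hc0, ⟨k, hk, hbB⟩, fun t => ?_⟩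
    have hmem : b - t • c ∈ A i₀ := (A i₀).sub_mem hbA ((A i₀).smul_mem t hcA)
    obtain ⟨j, hj⟩ := hA.exists_mem_of_mem _ hmem
    have hjj : j ≠ j₀ := by
      rintro rfl
      refine hb0 (hA.eq_zero k j hk b hbA hbB ?_)
      exact ((B j).sub_mem_iff_left ((B j).smul_mem t hcB)).1 hj
    obtain ⟨i, hi⟩ := hB' j hjj
    refine ⟨j, hjj, ?_⟩
    rw [← hA.inf_eq_span hmem hj, inf_eq_right.2 (hA.le_of_le hi)]
    intro h0
    exact one_ne_zero (hli 1 (-t) (by rw [← h0]; module)).1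
  obtain ⟨c, hc0, hcA, hcB⟩ := hA.exists_mem j₀
  obtain ⟨b, hbA, hbc, hAspan, -, hBs⟩ := main hA hB' c hcA hcB hc0
  obtain ⟨a, haB, hac, hBspan, ⟨i, hi, hai⟩, hAs⟩ := main hB hA' c hcB hcA hc0
  refine ⟨a, b, c, Fintype.linearIndependent_iff.2 fun r hr => ?_, hAspan, hBspan, hAs, hBs⟩
  simp only [Fin.sum_univ_three, Matrix.cons_val] at hr
  have h0 : r 0 = 0 := by
    by_contra h0
    have ha : a ∈ A i₀ := by
      refine ((A i₀).smul_mem_iff h0).1 ?_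
      rw [add_assoc] at hr
      rw [eq_neg_of_add_eq_zero_left hr]
      exact (A i₀).neg_mem ((A i₀).add_mem ((A i₀).smul_mem _ hbA) ((A i₀).smul_mem _ hcA))
    have := hac 1 0 (by rw [hA.eq_zero' i hi.symm a ha hai]; simp)
    exact one_ne_zero this.1
  rw [h0, zero_smul, zero_add] at hr
  obtain ⟨h1, h2⟩ := hbc _ _ hr
  intro i
  fin_cases i
  exacts [h0, h1, h2]

/-- The configuration of two opposite reguli. -/
lemma exists_reguli (hι : Fintype.card ι = Fintype.card K + 1)
    (hA : ∀ i, IsTransversal A B i) (hB : ∀ j, IsTransversal B A j) :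
    ∃ a b c d : D, LinearIndependent K ![a, b, c, d] ∧ ∃ α β : ι → K,
      (∀ i, (α i, β i) ≠ 0) ∧ (∀ i j, i ≠ j → α i * β j ≠ α j * β i) ∧
      (∀ i, A i = Submodule.span K {α i • a + β i • b, α i • c + β i • d}) ∧
      ∃ σ : ι → ι, Function.Injective σ ∧
        ∀ i, B (σ i) = Submodule.span K {α i • a + β i • c, α i • b + β i • d} := by
  obtain ⟨i₀, i₁, i₂, h01, h02, h12⟩ := Fintype.two_lt_card_iff.1
    (show 2 < Fintype.card ι by have := Fintype.one_lt_card (α := K); omega)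
  have hAz : ∀ i k, i ≠ k → ∀ x ∈ A i, x ∈ A k → x = 0 := fun i => (hA i).eq_zero'
  have hBz : ∀ i k, i ≠ k → ∀ x ∈ B i, x ∈ B k → x = 0 := fun i => (hB i).eq_zero'
  have split : ∀ j, ∃ u v, u ≠ 0 ∧ v ≠ 0 ∧ u ∈ A i₀ ∧ v ∈ A i₁ ∧ u ∈ B j ∧ v ∈ B j ∧
      u + v ∈ A i₂ := fun j => by
    obtain ⟨p, hp0, hpA, hpB⟩ := (hA i₂).exists_mem j
    have hp := hpB
    rw [← (hB j).sup_eq i₀ i₁ h01] at hp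
    obtain ⟨u, hu, v, hv, rfl⟩ := Submodule.mem_sup.1 hp
    refine ⟨u, v, ?_, ?_, hu.2, hv.2, hu.1, hv.1, hpA⟩
    · rintro rfl
      exact hp0 (hAz i₁ i₂ h12 _ (by simpa using hv.2) hpA)
    · rintro rfl
      exact hp0 (hAz i₀ i₂ h02 _ (by simpa using hu.2) hpA)
  obtain ⟨a, b, ha0, hb0, haA, hbA, haB, hbB, hab⟩ := split i₀
  obtain ⟨c, d, hc0, hd0, hcA, hdA, hcB, hdB, hcd⟩ := split i₁
  have hac : ∀ s t : K, s • a + t • c = 0 → s = 0 ∧ t = 0 := fun s t =>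
    eq_zero_of_smul_add_smul_eq_zero (hBz i₀ i₁ h01) haB ha0 hcB hc0
  have hbd : ∀ s t : K, s • b + t • d = 0 → s = 0 ∧ t = 0 := fun s t =>
    eq_zero_of_smul_add_smul_eq_zero (hBz i₀ i₁ h01) hbB hb0 hdB hd0
  have hab' : ∀ s t : K, s • a + t • b = 0 → s = 0 ∧ t = 0 := fun s t =>
    eq_zero_of_smul_add_smul_eq_zero (hAz i₀ i₁ h01) haA ha0 hbA hb0
  have hcd' : ∀ s t : K, s • c + t • d = 0 → s = 0 ∧ t = 0 := fun s t =>
    eq_zero_of_smul_add_smul_eq_zero (hAz i₀ i₁ h01) hcA hc0 hdA hd0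
  have hAmem : ∀ s t : K, s • a + t • c ∈ A i₀ ∧ s • b + t • d ∈ A i₁ := fun s t =>
    ⟨(A i₀).add_mem ((A i₀).smul_mem s haA) ((A i₀).smul_mem t hcA),
      (A i₁).add_mem ((A i₁).smul_mem s hbA) ((A i₁).smul_mem t hdA)⟩
  have hBmem : ∀ s t : K, s • a + t • b ∈ B i₀ ∧ s • c + t • d ∈ B i₁ := fun s t =>
    ⟨(B i₀).add_mem ((B i₀).smul_mem s haB) ((B i₀).smul_mem t hbB),
      (B i₁).add_mem ((B i₁).smul_mem s hcB) ((B i₁).smul_mem t hdB)⟩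
  have hli : ∀ s t u v : K, s • a + t • b + u • c + v • d = 0 →
      s = 0 ∧ t = 0 ∧ u = 0 ∧ v = 0 := by
    intro s t u v h
    have h1 : (s • a + u • c) + (t • b + v • d) = 0 := by rw [← h]; abel
    have h2 : s • a + u • c = 0 := hAz i₀ i₁ h01 _ (hAmem s u).1 (by
      rw [eq_neg_of_add_eq_zero_left h1]
      exact (A i₁).neg_mem (hAmem t v).2)
    rw [h2, zero_add] at h1
    exact ⟨(hac _ _ h2).1, (hbd _ _ h1).1, (hac _ _ h2).2, (hbd _ _ h1).2⟩
  have hBspan : ∀ s t : K, (s, t) ≠ 0 →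
      ∃ j, B j = Submodule.span K {s • a + t • c, s • b + t • d} := by
    intro s t hst
    have hmem : (s • a + t • c) + (s • b + t • d) ∈ A i₂ := by
      have := (A i₂).add_mem ((A i₂).smul_mem s hab) ((A i₂).smul_mem t hcd)
      convert this using 1
      module
    obtain ⟨j, hj⟩ := (hA i₂).exists_mem_of_mem _ hmem
    exact ⟨j, (hB j).eq_span_pair_of_add_mem h01 (hAz i₀ i₁ h01) (hAmem s t).1
      (fun h => hst (Prod.ext (hac _ _ h).1 (hac _ _ h).2)) (hAmem s t).2
      (fun h => hst (Prod.ext (hbd _ _ h).1 (hbd _ _ h).2)) hj⟩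
  obtain ⟨k, hk⟩ := hBspan 1 1 (by simp)
  have hAspan : ∀ i, ∃ s t : K, (s, t) ≠ 0 ∧
      A i = Submodule.span K {s • a + t • b, s • c + t • d} := by
    intro i
    obtain ⟨p, hp0, hpA, hpB⟩ := (hA i).exists_mem k
    rw [hk] at hpB
    obtain ⟨s, t, rfl⟩ := Submodule.mem_span_pair.1 hpB
    have hst : (s, t) ≠ 0 := fun h => hp0 (by
      obtain ⟨rfl, rfl⟩ := Prod.mk.inj h
      simp)
    refine ⟨s, t, hst, (hA i).eq_span_pair_of_add_mem h01 (hBz i₀ i₁ h01) (hBmem s t).1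
      (fun h => hst (Prod.ext (hab' _ _ h).1 (hab' _ _ h).2)) (hBmem s t).2
      (fun h => hst (Prod.ext (hcd' _ _ h).1 (hcd' _ _ h).2)) ?_⟩
    convert hpA using 1
    module
  choose α β hαβ0 hAαβ using hAspan
  choose σ hσ using fun i => hBspan (α i) (β i) (hαβ0 i)
  have hprop : ∀ i j, i ≠ j → α i * β j ≠ α j * β i := by
    intro i j hij he
    have hi : α i • a + β i • b ∈ A i := hAαβ i ▸ Submodule.subset_span (by simp)
    have hj : α j • a + β j • b ∈ A j := hAαβ j ▸ Submodule.subset_span (by simp)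
    have hi0 : α i • a + β i • b ≠ 0 := fun h =>
      hαβ0 i (Prod.ext (hab' _ _ h).1 (hab' _ _ h).2)
    have hj0 : α j • a + β j • b ≠ 0 := fun h =>
      hαβ0 j (Prod.ext (hab' _ _ h).1 (hab' _ _ h).2)
    have h1 := eq_zero_of_smul_add_smul_eq_zero (hAz i j hij) hi hi0 hj hj0
      (s := β j) (t := -β i) (by linear_combination (norm := module) he • a)
    have h2 := eq_zero_of_smul_add_smul_eq_zero (hAz i j hij) hi hi0 hj hj0
      (s := α j) (t := -α i) (by linear_combination (norm := module) -(he • b))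
    exact hαβ0 j (Prod.ext h2.1 h1.1)
  refine ⟨a, b, c, d, Fintype.linearIndependent_iff.2 fun r hr => ?_, α, β, hαβ0, hprop, hAαβ, σ,
    fun i j hij => ?_, hσ⟩
  · simp only [Fin.sum_univ_four, Matrix.cons_val] at hr
    obtain ⟨h0, h1, h2, h3⟩ := hli _ _ _ _ hr
    intro i
    fin_cases i
    exacts [h0, h1, h2, h3]
  · by_contra hne
    have hmem : α i • a + β i • c ∈ B (σ j) := hij ▸ hσ i ▸ Submodule.subset_span (by simp)
    rw [hσ j] at hmem
    obtain ⟨s, t, hst⟩ := Submodule.mem_span_pair.1 hmem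
    obtain ⟨h0, -, h2, -⟩ := hli (s * α j - α i) (t * α j) (s * β j - β i) (t * β j) (by
      linear_combination (norm := module) hst)
    exact hprop i j hne (by linear_combination β j * (-h0) + α j * h2)

end Dual

section Primal

variable {K W : Type*} [Field K] [AddCommGroup W] [Module K W]

/-- Linearly independent functionals are part of a system of coordinates. -/
lemma exists_dual_vectors [FiniteDimensional K W] {n : ℕ} {f : Fin n → Module.Dual K W}
    (hf : LinearIndependent K f) :
    ∃ x : Fin n → W, (∀ i j, f i (x j) = if i = j then 1 else 0) ∧ LinearIndependent K x ∧
      (⨅ i, LinearMap.ker (f i)) ⊓ Submodule.span K (Set.range x) = ⊥ := by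
  obtain ⟨g, hg⟩ := LinearMap.exists_leftInverse_of_injective (Fintype.linearCombination K f)
    (LinearMap.ker_eq_bot.2 hf.fintypeLinearCombination_injective)
  have hx : ∀ i j, f i ((Module.evalEquiv K W).symm (LinearMap.proj j ∘ₗ g)) =
      if i = j then 1 else 0 := fun i j => by
    rw [Module.apply_evalEquiv_symm_apply]
    have := congrFun (LinearMap.congr_fun hg (Pi.single i 1)) j
    simpa [Fintype.linearCombination_apply_single, Pi.single_apply, eq_comm] using this
  refine ⟨fun j => (Module.evalEquiv K W).symm (LinearMap.proj j ∘ₗ g), hx,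
    LinearIndependent.of_pairwise_dual_eq_zero_one _ f (fun i j hij => ?_) (fun i => ?_),
    (Submodule.eq_bot_iff _).2 ?_⟩
  · simp [hx, hij]
  · simp [hx]
  · rintro w ⟨hw, hws⟩
    obtain ⟨c, rfl⟩ := (Submodule.mem_span_range_iff_exists_fun K).1 hws
    have hc : ∀ i, c i = 0 := fun i => by
      have : f i _ = 0 := (Submodule.mem_iInf _).1 hw i
      simpa [hx] using this
    simp [hc]

lemma mem_iff_of_dualAnnihilator_eq_span {X : Submodule K W} {s : Set (Module.Dual K W)}
    (h : X.dualAnnihilator = Submodule.span K s) (w : W) : w ∈ X ↔ ∀ f ∈ s, f w = 0 := by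
  rw [← Subspace.forall_mem_dualAnnihilator_apply_eq_zero_iff, h]
  refine ⟨fun hw f hf => hw f (Submodule.subset_span hf), fun hw f hf => ?_⟩
  have : Submodule.span K s ≤ LinearMap.ker (Module.Dual.eval K W w) :=
    Submodule.span_le.2 fun f hf => hw f hf
  exact this hf

lemma Submodule.eq_sup_span_singleton {S X : Submodule K W} {u : W} (hS : S ≤ X) (hu : u ∈ X)
    (h : ∀ w ∈ X, ∃ s : K, w - s • u ∈ S) : X = S ⊔ Submodule.span K {u} := by
  refine le_antisymm (fun w hw => ?_)
    (sup_le hS ((Submodule.span_singleton_le_iff_mem _ _).2 hu))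
  obtain ⟨s, hs⟩ := h w hw
  exact Submodule.mem_sup.2
    ⟨_, hs, s • u, Submodule.mem_span_singleton.2 ⟨s, rfl⟩, sub_add_cancel _ _⟩

lemma Submodule.eq_sup_span_pair {S X : Submodule K W} {u v : W} (hS : S ≤ X) (hu : u ∈ X)
    (hv : v ∈ X) (h : ∀ w ∈ X, ∃ s t : K, w - (s • u + t • v) ∈ S) :
    X = S ⊔ Submodule.span K {u, v} := by
  refine le_antisymm (fun w hw => ?_) (sup_le hS (Submodule.span_le.2 ?_))
  · obtain ⟨s, t, hst⟩ := h w hw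
    exact Submodule.mem_sup.2
      ⟨_, hst, _, Submodule.mem_span_pair.2 ⟨s, t, rfl⟩, sub_add_cancel _ _⟩
  · rintro _ (rfl | rfl)
    exacts [hu, hv]

lemma exists_eq_mul_neg_and_eq_mul {α β x y : K} (h0 : (α, β) ≠ 0) (h : α * x + β * y = 0) :
    ∃ s, x = s * -β ∧ y = s * α := by
  by_cases hα : α = 0
  · subst hα
    have hβ : β ≠ 0 := by simpa using h0
    exact ⟨-x / β, by field_simp, by simpa [hβ] using h⟩
  · exact ⟨y / α, by field_simp; linear_combination h, by field_simp⟩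

variable [Fintype K] [FiniteDimensional K W] {U V : Fin (Fintype.card K + 1) → Submodule K W}

lemma isTypeA_of_dualAnnihilator {f g : Module.Dual K W} (hfg : LinearIndependent K ![f, g])
    (hlast : (V (Fin.last _)).dualAnnihilator = Submodule.span K {f, g})
    (hV : ∀ i ≠ Fin.last _, (V i).dualAnnihilator = ⊥) {α β : Fin (Fintype.card K + 1) → K}
    (h0 : ∀ i, (α i, β i) ≠ 0) (hprop : ∀ i j, i ≠ j → α i * β j ≠ α j * β i)
    (hU : ∀ i, (U i).dualAnnihilator = Submodule.span K {α i • f + β i • g}) :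
    IsTypeA U V := by
  obtain ⟨x, hx, hli, hinf⟩ := exists_dual_vectors hfg
  have hx2 : ![x 0, x 1] = x := by ext i; fin_cases i <;> rfl
  have hxs : Set.range x = {x 0, x 1} := by
    ext w; simp [Fin.exists_fin_succ, eq_comm]
  have hS : ∀ w, w ∈ ⨅ i, LinearMap.ker (![f, g] i) ↔ f w = 0 ∧ g w = 0 := by
    simp [Fin.forall_fin_succ]
  generalize (⨅ i, LinearMap.ker (![f, g] i)) = S at hS hinf
  simp only [Fin.forall_fin_succ] at hx
  simp at hx
  obtain ⟨⟨f0, f1⟩, g0, g1⟩ := hx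
  refine ⟨_, x 0, x 1, hx2.symm ▸ hli, hxs ▸ hinf, fun i hi => ?_, ?_, fun i => -β i, α,
    fun i h => h0 i ?_, fun i j hij h => hprop i j hij ?_, fun i => ?_⟩
  · have hm := mem_iff_of_dualAnnihilator_eq_span (s := ∅) (X := V i) (by simpa using hV i hi)
    refine Submodule.eq_sup_span_pair (fun w _ => ?_) ?_ ?_ fun w _ => ⟨f w, g w, ?_⟩
    all_goals simp [hm, hS, f0, f1, g0, g1]
  · ext w
    rw [mem_iff_of_dualAnnihilator_eq_span hlast, hS]
    simp
  · simp at h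
    simp [h]
  · linear_combination h
  · have hm := mem_iff_of_dualAnnihilator_eq_span (hU i)
    simp only [Set.mem_singleton_iff, forall_eq, LinearMap.add_apply, LinearMap.smul_apply,
      smul_eq_mul] at hm
    refine Submodule.eq_sup_span_singleton (fun w hw => ?_) ?_ fun w hw => ?_
    · obtain ⟨h1, h2⟩ := (hS w).1 hw
      simp [hm, h1, h2]
    · simp [hm, f0, f1, g0, g1]
      ring
    · obtain ⟨s, h1, h2⟩ := exists_eq_mul_neg_and_eq_mul (h0 i) ((hm w).1 hw)
      exact ⟨s, by simp [hS, f0, f1, g0, g1, h1, h2]⟩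

lemma isTypeB_of_dualAnnihilator {f g h : Module.Dual K W} (hfgh : LinearIndependent K ![f, g, h])
    {α : Fin (Fintype.card K) → K} (hα : Function.Bijective α)
    (hVlast : (V (Fin.last _)).dualAnnihilator = Submodule.span K {g, h})
    (hV : ∀ i : Fin (Fintype.card K),
      (V i.castSucc).dualAnnihilator = Submodule.span K {f - α i • h})
    (hUlast : (U (Fin.last _)).dualAnnihilator = Submodule.span K {f, h})
    (hU : ∀ i : Fin (Fintype.card K),
      (U i.castSucc).dualAnnihilator = Submodule.span K {g - α i • h}) :
    IsTypeB U V := by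
  obtain ⟨x, hx, hli, hinf⟩ := exists_dual_vectors hfgh
  have hx3 : ![x 0, x 1, x 2] = x := by ext i; fin_cases i <;> rfl
  have hxs : Set.range x = {x 0, x 1, x 2} := by
    ext w; simp [Fin.exists_fin_succ, eq_comm]
  have hS : ∀ w, w ∈ ⨅ i, LinearMap.ker (![f, g, h] i) ↔ f w = 0 ∧ g w = 0 ∧ h w = 0 := by
    simp [Fin.forall_fin_succ]
  generalize (⨅ i, LinearMap.ker (![f, g, h] i)) = S at hS hinf
  simp only [Fin.forall_fin_succ] at hx
  simp at hx
  obtain ⟨⟨f0, f1, f2⟩, ⟨g0, g1, g2⟩, k0, k1, k2⟩ := hx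
  have hmVl := mem_iff_of_dualAnnihilator_eq_span hVlast
  have hmUl := mem_iff_of_dualAnnihilator_eq_span hUlast
  have hmV := fun i => mem_iff_of_dualAnnihilator_eq_span (hV i)
  have hmU := fun i => mem_iff_of_dualAnnihilator_eq_span (hU i)
  simp only [Set.mem_insert_iff, Set.mem_singleton_iff, forall_eq, forall_eq_or_imp,
    LinearMap.sub_apply, LinearMap.smul_apply, smul_eq_mul, sub_eq_zero] at hmVl hmUl hmV hmU
  refine ⟨_, x 0, x 1, x 2, hx3.symm ▸ hli, hxs ▸ hinf, α, hα, ?_, fun i => ?_, ?_, fun i => ?_⟩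
  · refine Submodule.eq_sup_span_singleton (fun w hw => ?_) ?_ fun w hw => ⟨f w, ?_⟩
    all_goals simp_all
  · refine Submodule.eq_sup_span_pair (fun w hw => ?_) ?_ ?_ fun w hw => ⟨g w, h w, ?_⟩
    all_goals simp_all [mul_comm]
  · refine Submodule.eq_sup_span_singleton (fun w hw => ?_) ?_ fun w hw => ⟨g w, ?_⟩
    all_goals simp_all
  · refine Submodule.eq_sup_span_pair (fun w hw => ?_) ?_ ?_ fun w hw => ⟨f w, h w, ?_⟩
    all_goals simp_all [mul_comm]

lemma isTypeC_of_dualAnnihilator {f g h k : Module.Dual K W}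
    (hli : LinearIndependent K ![f, g, h, k]) {α β : Fin (Fintype.card K + 1) → K}
    (h0 : ∀ i, (α i, β i) ≠ 0) (hprop : ∀ i j, i ≠ j → α i * β j ≠ α j * β i)
    (hV : ∀ i, (V i).dualAnnihilator = Submodule.span K {α i • f + β i • g, α i • h + β i • k})
    (hU : ∀ i, (U i).dualAnnihilator = Submodule.span K {α i • f + β i • h, α i • g + β i • k}) :
    IsTypeC U V := by
  obtain ⟨x, hx, hli, hinf⟩ := exists_dual_vectors hli
  have hx4 : ![x 0, x 1, x 2, x 3] = x := by ext i; fin_cases i <;> rfl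
  have hxs : Set.range x = {x 0, x 1, x 2, x 3} := by
    ext w; simp [Fin.exists_fin_succ, eq_comm]
  have hS : ∀ w, w ∈ ⨅ i, LinearMap.ker (![f, g, h, k] i) ↔
      f w = 0 ∧ g w = 0 ∧ h w = 0 ∧ k w = 0 := by
    simp [Fin.forall_fin_succ]
  generalize (⨅ i, LinearMap.ker (![f, g, h, k] i)) = S at hS hinf
  simp only [Fin.forall_fin_succ] at hx
  simp at hx
  obtain ⟨⟨f0, f1, f2, f3⟩, ⟨g0, g1, g2, g3⟩, ⟨k0, k1, k2, k3⟩, l0, l1, l2, l3⟩ := hx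
  have hmV := fun i => mem_iff_of_dualAnnihilator_eq_span (hV i)
  have hmU := fun i => mem_iff_of_dualAnnihilator_eq_span (hU i)
  simp only [Set.mem_insert_iff, Set.mem_singleton_iff, forall_eq, forall_eq_or_imp,
    LinearMap.add_apply, LinearMap.smul_apply, smul_eq_mul] at hmV hmU
  refine ⟨_, x 0, x 1, x 2, x 3, hx4.symm ▸ hli, hxs ▸ hinf, fun i => -β i, α,
    fun i h => h0 i ?_, fun i j hij h => hprop i j hij ?_, fun i => ?_, fun i => ?_⟩
  · simp at h
    simp [h]
  · linear_combination h
  · refine Submodule.eq_sup_span_pair (fun w hw => ?_) ?_ ?_ fun w hw => ?_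
    · simp_all
    · simp_all [mul_comm]
    · simp_all [mul_comm]
    · obtain ⟨s, h1, h2⟩ := exists_eq_mul_neg_and_eq_mul (h0 i) ((hmV i w).1 hw).1
      obtain ⟨t, h3, h4⟩ := exists_eq_mul_neg_and_eq_mul (h0 i) ((hmV i w).1 hw).2
      exact ⟨s, t, by simp_all⟩
  · refine Submodule.eq_sup_span_pair (fun w hw => ?_) ?_ ?_ fun w hw => ?_
    · simp_all
    · simp_all [mul_comm]
    · simp_all [mul_comm]
    · obtain ⟨s, h1, h2⟩ := exists_eq_mul_neg_and_eq_mul (h0 i) ((hmU i w).1 hw).1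
      obtain ⟨t, h3, h4⟩ := exists_eq_mul_neg_and_eq_mul (h0 i) ((hmU i w).1 hw).2
      exact ⟨s, t, by simp_all⟩

end Primal

section Counting

variable {K W : Type*} [Field K] [Fintype K] [AddCommGroup W] [Module K W]
  [FiniteDimensional K W]

lemma inv_card_mul_card_inf_ker (X : Submodule K W) (f : Module.Dual K W) :
    (Nat.card X : ℝ)⁻¹ * Nat.card ↥(X ⊓ LinearMap.ker f) =
      if f ∈ X.dualAnnihilator then 1 else (Fintype.card K : ℝ)⁻¹ := by
  have := Module.finite_of_finite K (M := W)
  split_ifs with h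
  · have : X ≤ LinearMap.ker f := fun w hw => (Submodule.mem_dualAnnihilator f).1 h w hw
    rw [inf_eq_left.2 this]
    exact inv_mul_cancel₀ (Nat.cast_ne_zero.2 Nat.card_pos.ne')
  · have hne : f ∘ₗ X.subtype ≠ 0 := fun h0 =>
      h ((Submodule.mem_dualAnnihilator f).2 fun w hw => LinearMap.congr_fun h0 ⟨w, hw⟩)
    have h1 := Submodule.card_eq_card_quotient_mul_card (LinearMap.ker (f ∘ₗ X.subtype))
    rw [Nat.card_congr
        (LinearMap.quotKerEquivOfSurjective _ (LinearMap.surjective hne)).toEquiv,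
      Nat.card_congr (Submodule.equivSubtypeMap X _).toEquiv, LinearMap.ker_comp,
      Submodule.map_comap_subtype, Nat.card_eq_fintype_card (α := K)] at h1
    have h2 : (Nat.card ↥(X ⊓ LinearMap.ker f) : ℝ) ≠ 0 := Nat.cast_ne_zero.2 Nat.card_pos.ne'
    have h3 : (Fintype.card K : ℝ) ≠ 0 := Nat.cast_ne_zero.2 Fintype.card_ne_zero
    rw [h1, Nat.cast_mul]
    field_simp

/-- The dual form of the isometry equation. -/
lemma IsometrySolution.card_filter_mem_dualAnnihilator_eq {m : ℕ} {U V : Fin m → Submodule K W}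
    (h : IsometrySolution U V) (f : Module.Dual K W) :
    #{i | f ∈ (V i).dualAnnihilator} = #{i | f ∈ (U i).dualAnnihilator} := by
  have := Module.finite_of_finite K (M := W)
  have := Fintype.ofFinite W
  have hsum : ∀ X : Fin m → Submodule K W,
      ∑ w with f w = 0, ∑ i, ((Nat.card ↥(X i) : ℝ))⁻¹ * (if w ∈ X i then 1 else 0) =
        ∑ i, if f ∈ (X i).dualAnnihilator then 1 else (Fintype.card K : ℝ)⁻¹ := fun X => by
    rw [sum_comm]
    refine sum_congr rfl fun i _ => ?_
    rw [← inv_card_mul_card_inf_ker, ← mul_sum, sum_boole, filter_filter]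
    congr 2
    exact (Nat.subtype_card _ (by simp [and_comm])).symm
  have hq : (Fintype.card K : ℝ)⁻¹ < 1 :=
    inv_lt_one_of_one_lt₀ (Nat.one_lt_cast.2 Fintype.one_lt_card)
  have hcard : ∀ X : Fin m → Submodule K W,
      (∑ i, if f ∈ (X i).dualAnnihilator then 1 else (Fintype.card K : ℝ)⁻¹) =
        m * (Fintype.card K : ℝ)⁻¹ +
          #{i | f ∈ (X i).dualAnnihilator} * (1 - (Fintype.card K : ℝ)⁻¹) := fun X => by
    have : ∀ i, (if f ∈ (X i).dualAnnihilator then 1 else (Fintype.card K : ℝ)⁻¹) =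
        (Fintype.card K : ℝ)⁻¹ +
          (if f ∈ (X i).dualAnnihilator then 1 else 0) * (1 - (Fintype.card K : ℝ)⁻¹) :=
      fun i => by split_ifs <;> ring
    simp_rw [this, sum_add_distrib, ← sum_mul, sum_boole]
    simp
  have heq := (hsum V).symm.trans ((sum_congr rfl fun w _ => h w).trans (hsum U))
  rw [hcard, hcard] at heq
  exact_mod_cast mul_right_cancel₀ (sub_ne_zero.2 hq.ne') (add_left_cancel heq)

end Counting

section Classification

lemma exists_perm_castSucc_eq {n : ℕ} {j₀ : Fin (n + 1)} {g : Fin n → Fin (n + 1)}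
    (hg : Function.Injective g) (hj₀ : ∀ i, g i ≠ j₀) :
    ∃ σ : Equiv.Perm (Fin (n + 1)), σ (Fin.last n) = j₀ ∧ ∀ i : Fin n, σ i.castSucc = g i :=
  ⟨Equiv.ofBijective (Fin.snoc (α := fun _ => Fin (n + 1)) g j₀) <|
    Finite.injective_iff_bijective.1 <| Fin.snoc_injective_iff.2 ⟨hg, by simpa using hj₀⟩,
    by simp, by simp⟩

lemma span_sub_smul_injective {K D : Type*} [Field K] [AddCommGroup D] [Module K D] {a c : D}
    (h : LinearIndependent K ![a, c]) :
    Function.Injective fun t : K => Submodule.span K {a - t • c} := fun s t hst => by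
  obtain ⟨r, hr⟩ := Submodule.mem_span_singleton.1
    (hst.le (Submodule.mem_span_singleton_self (a - s • c)))
  obtain ⟨h1, h2⟩ := LinearIndependent.pair_iff.1 h (r - 1) (s - r * t)
    (by linear_combination (norm := module) hr)
  linear_combination h2 + t * h1

variable {K W : Type*} [Field K] [Fintype K] [AddCommGroup W] [Module K W]
  [FiniteDimensional K W] {U V : Fin (Fintype.card K + 1) → Submodule K W}

lemma exists_isType_of_not_le
    (hcount : ∀ f : Module.Dual K W,
      #{i | f ∈ (V i).dualAnnihilator} = #{i | f ∈ (U i).dualAnnihilator})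
    (hbot : ∀ f : Module.Dual K W, (∀ i, f ∈ (V i).dualAnnihilator) →
      (∀ i, f ∈ (U i).dualAnnihilator) → f = 0)
    {i₀ : Fin (Fintype.card K + 1)}
    (hi₀ : ∀ j, ¬ (V i₀).dualAnnihilator ≤ (U j).dualAnnihilator) :
    ∃ π σ : Equiv.Perm (Fin (Fintype.card K + 1)),
      IsTypeA (U ∘ σ) (V ∘ π) ∨ IsTypeB (U ∘ σ) (V ∘ π) ∨ IsTypeC (U ∘ σ) (V ∘ π) := by
  set A := fun i => (V i).dualAnnihilator with hA
  set B := fun i => (U i).dualAnnihilator with hB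
  have hι : Fintype.card (Fin (Fintype.card K + 1)) = Fintype.card K + 1 := Fintype.card_fin _
  have hcount' : ∀ x, #{i | x ∈ B i} = #{i | x ∈ A i} := fun x => (hcount x).symm
  have hbot' : ∀ x, (∀ i, x ∈ B i) → (∀ i, x ∈ A i) → x = 0 := fun x h h' => hbot x h' h
  have hAt : ∀ {i}, (∀ j, ¬ A i ≤ B j) → IsTransversal A B i :=
    isTransversal_of_not_le hι hcount hbot
  have hBt : ∀ {j}, (∀ i, ¬ B j ≤ A i) → IsTransversal B A j :=
    isTransversal_of_not_le hι hcount' hbot'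
  by_cases hex : ∃ j₀, ∀ i, ¬ B j₀ ≤ A i
  swap
  · push Not at hex
    obtain ⟨f, g, hfg, hi, hbot, α, β, h0, hprop, hpts⟩ :=
      exists_points_of_forall_le hι hcount (hAt hi₀) hex
    refine ⟨Equiv.swap (Fin.last _) i₀, 1, Or.inl (isTypeA_of_dualAnnihilator hfg ?_
      (fun i hi' => hbot _ fun h => hi' ?_) h0 hprop hpts)⟩
    · simpa using hi
    · rw [Equiv.swap_apply_eq_iff] at h
      simpa using h
  obtain ⟨j₀, hj₀⟩ := hex
  by_cases hall : (∀ i j, ¬ A i ≤ B j) ∧ ∀ j i, ¬ B j ≤ A i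
  · obtain ⟨a, b, c, d, hli, α, β, h0, hprop, hA', σ, hσ, hB'⟩ :=
      exists_reguli hι (fun i => hAt (hall.1 i)) (fun j => hBt (hall.2 j))
    exact ⟨1, Equiv.ofBijective σ (Finite.injective_iff_bijective.1 hσ),
      Or.inr (Or.inr (isTypeC_of_dualAnnihilator hli h0 hprop hA' hB'))⟩
  have hB' : (∃ i j, A i ≤ B j) → ∀ j ≠ j₀, ∃ i, B j ≤ A i := fun ⟨i, hi⟩ j hj => by
    by_contra! h
    exact hj ((hBt hj₀).eq_of_le hi (hBt h))
  have hA' : (∃ j i, B j ≤ A i) → ∀ i ≠ i₀, ∃ j, A i ≤ B j := fun ⟨j, hj⟩ i hi => by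
    by_contra! h
    exact hi ((hAt hi₀).eq_of_le hj (hAt h))
  have hle : (∃ i j, A i ≤ B j) ∧ ∃ j i, B j ≤ A i := by
    obtain ⟨i, hi⟩ := exists_ne i₀
    obtain ⟨j, hj⟩ := exists_ne j₀
    by_cases h : ∃ i j, A i ≤ B j
    · exact ⟨h, j, hB' h j hj⟩
    · have h' : ∃ j i, B j ≤ A i := by
        by_contra! h'
        exact hall ⟨by simpa using h, h'⟩
      exact ⟨⟨i, hA' h' i hi⟩, h'⟩
  obtain ⟨a, b, c, hli, hAi₀, hBj₀, hAl, hBl⟩ :=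
    exists_lines_of_le hι (hAt hi₀) (hBt hj₀) (hA' hle.2) (hB' hle.1)
  choose g hg hgA using hAl
  choose g' hg' hgB using hBl
  have hac : LinearIndependent K ![a, c] :=
    (show ![a, b, c] ∘ ![0, 2] = ![a, c] by funext i; fin_cases i <;> rfl) ▸
      hli.comp ![0, 2] (by decide)
  have hbc : LinearIndependent K ![b, c] :=
    (show ![a, b, c] ∘ ![1, 2] = ![b, c] by funext i; fin_cases i <;> rfl) ▸
      hli.comp ![1, 2] (by decide)
  let α := (Fintype.equivFin K).symm
  obtain ⟨π, hπ, hπ'⟩ := exists_perm_castSucc_eq (g := g ∘ α)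
    (fun s t h => α.injective <| span_sub_smul_injective hac <| by
      simp only [← hgA]; exact congrArg A h) fun i => hg _
  obtain ⟨σ, hσ, hσ'⟩ := exists_perm_castSucc_eq (g := g' ∘ α)
    (fun s t h => α.injective <| span_sub_smul_injective hbc <| by
      simp only [← hgB]; exact congrArg B h) fun i => hg' _
  refine ⟨π, σ, Or.inr (Or.inl (isTypeB_of_dualAnnihilator hli α.bijective ?_ (fun i => ?_) ?_
    fun i => ?_))⟩
  · simpa [hπ] using hAi₀
  · simpa [hπ'] using hgA (α i)
  · simpa [hσ] using hBj₀
  · simpa [hσ'] using hgB (α i)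

lemma exists_isType_of_forall_dual
    (hsol : IsometrySolution U V) (hnontriv : ¬ TuplesEquiv U V)
    (hbot : ∀ f : Module.Dual K W, (∀ i, f ∈ (V i).dualAnnihilator) →
      (∀ i, f ∈ (U i).dualAnnihilator) → f = 0) :
    ∃ U' V' : Fin (Fintype.card K + 1) → Submodule K W,
      ((TuplesEquiv U U' ∧ TuplesEquiv V V') ∨ (TuplesEquiv U V' ∧ TuplesEquiv V U')) ∧
      (IsTypeA U' V' ∨ IsTypeB U' V' ∨ IsTypeC U' V') := by
  have hcount := hsol.card_filter_mem_dualAnnihilator_eq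
  rcases exists_forall_not_le (Fintype.card_fin _) hcount fun ⟨σ, hσ⟩ =>
    hnontriv ⟨σ, fun i => Subspace.dualAnnihilator_inj.1 (hσ i)⟩ with ⟨i, hi⟩ | ⟨j, hj⟩
  · obtain ⟨π, σ, h⟩ := exists_isType_of_not_le hcount hbot hi
    exact ⟨U ∘ σ, V ∘ π, Or.inl ⟨⟨σ, fun _ => rfl⟩, π, fun _ => rfl⟩, h⟩
  · obtain ⟨π, σ, h⟩ := exists_isType_of_not_le (fun f => (hcount f).symm)
      (fun f h h' => hbot f h' h) hj
    exact ⟨V ∘ σ, U ∘ π, Or.inr ⟨⟨π, fun _ => rfl⟩, σ, fun _ => rfl⟩, h⟩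

end Classification

section Map

variable {K W T : Type*} [Field K] [AddCommGroup W] [Module K W]
  [AddCommGroup T] [Module K T] {f : T →ₗ[K] W}

lemma TuplesEquiv.map {m : ℕ} {U V : Fin m → Submodule K T} (h : TuplesEquiv U V)
    (f : T →ₗ[K] W) : TuplesEquiv (fun i => (U i).map f) fun i => (V i).map f :=
  h.imp fun _ hπ i => congrArg _ (hπ i)

lemma isometrySolution_map_iff {m : ℕ} {U V : Fin m → Submodule K T}
    (hf : Function.Injective f) :
    IsometrySolution (fun i => (U i).map f) (fun i => (V i).map f) ↔ IsometrySolution U V := by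
  have hcard : ∀ X : Submodule K T, Nat.card ↥(X.map f) = Nat.card X := fun X =>
    Nat.card_congr (Submodule.equivMapOfInjective f hf X).symm.toEquiv
  simp only [IsometrySolution, hcard]
  refine ⟨fun h w => by simpa [hf.eq_iff] using h (f w), fun h w => ?_⟩
  by_cases hw : ∃ t, f t = w
  · obtain ⟨t, rfl⟩ := hw
    simpa [hf.eq_iff] using h t
  · have : ∀ X : Submodule K T, w ∉ X.map f := fun X ⟨t, _, ht⟩ => hw ⟨t, ht⟩
    simp only [this, if_false, mul_zero]

variable [Fintype K] {U V : Fin (Fintype.card K + 1) → Submodule K T}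

lemma IsTypeA.map (h : IsTypeA U V) (hf : Function.Injective f) :
    IsTypeA (fun i => (U i).map f) fun i => (V i).map f := by
  obtain ⟨S, a, b, hli, hS, hV, hVl, α, β, h0, hprop, hU⟩ := h
  have hS' := congrArg (Submodule.map f) hS
  rw [Submodule.map_inf f hf] at hS'
  refine ⟨S.map f, f a, f b, ?_, ?_, fun i hi => ?_, congrArg _ hVl, α, β, h0, hprop,
    fun i => ?_⟩
  · exact (show f ∘ ![a, b] = ![f a, f b] by funext i; fin_cases i <;> rfl) ▸
      hli.map' f (LinearMap.ker_eq_bot.2 hf)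
  · simpa [Submodule.map_span, Set.image_insert_eq] using hS'
  · simp [hV i hi, Submodule.map_sup, Submodule.map_span, Set.image_insert_eq]
  · simp [hU i, Submodule.map_sup, Submodule.map_span]

lemma IsTypeB.map (h : IsTypeB U V) (hf : Function.Injective f) :
    IsTypeB (fun i => (U i).map f) fun i => (V i).map f := by
  obtain ⟨S, a, b, c, hli, hS, α, hα, hVl, hV, hUl, hU⟩ := h
  have hS' := congrArg (Submodule.map f) hS
  rw [Submodule.map_inf f hf] at hS'
  refine ⟨S.map f, f a, f b, f c, ?_, ?_, α, hα, ?_, fun i => ?_, ?_, fun i => ?_⟩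
  · exact (show f ∘ ![a, b, c] = ![f a, f b, f c] by funext i; fin_cases i <;> rfl) ▸
      hli.map' f (LinearMap.ker_eq_bot.2 hf)
  · simpa [Submodule.map_span, Set.image_insert_eq] using hS'
  · simp [hVl, Submodule.map_sup, Submodule.map_span]
  · simp [hV i, Submodule.map_sup, Submodule.map_span, Set.image_insert_eq]
  · simp [hUl, Submodule.map_sup, Submodule.map_span]
  · simp [hU i, Submodule.map_sup, Submodule.map_span, Set.image_insert_eq]

lemma IsTypeC.map (h : IsTypeC U V) (hf : Function.Injective f) :
    IsTypeC (fun i => (U i).map f) fun i => (V i).map f := by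
  obtain ⟨S, a, b, c, d, hli, hS, α, β, h0, hprop, hV, hU⟩ := h
  have hS' := congrArg (Submodule.map f) hS
  rw [Submodule.map_inf f hf] at hS'
  refine ⟨S.map f, f a, f b, f c, f d, ?_, ?_, α, β, h0, hprop, fun i => ?_, fun i => ?_⟩
  · exact (show f ∘ ![a, b, c, d] = ![f a, f b, f c, f d] by
      funext i; fin_cases i <;> rfl) ▸ hli.map' f (LinearMap.ker_eq_bot.2 hf)
  · simpa [Submodule.map_span, Set.image_insert_eq] using hS'
  · simp [hV i, Submodule.map_sup, Submodule.map_span, Set.image_insert_eq]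
  · simp [hU i, Submodule.map_sup, Submodule.map_span, Set.image_insert_eq]

end Map

/-- Every nontrivial solution of the isometry equation of length `|K| + 1` is equivalent,
as a pair, to a pair of Type A, Type B, or Type C. -/
theorem nontrivial_solution_classification
    (K W : Type*) [Field K] [Fintype K] [AddCommGroup W] [Module K W]
    [FiniteDimensional K W]
    (U V : Fin (Fintype.card K + 1) → Submodule K W)
    (hsol : IsometrySolution U V) (hnontriv : ¬ TuplesEquiv U V) :
    ∃ U' V' : Fin (Fintype.card K + 1) → Submodule K W,
      ((TuplesEquiv U U' ∧ TuplesEquiv V V') ∨ (TuplesEquiv U V' ∧ TuplesEquiv V U')) ∧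
      (IsTypeA U' V' ∨ IsTypeB U' V' ∨ IsTypeC U' V') := by
  obtain ⟨T, hT⟩ : ∃ T, T = (⨆ i, V i) ⊔ (⨆ i, U i) := ⟨_, rfl⟩
  have hmap : ∀ X ≤ T, (X.comap T.subtype).map T.subtype = X := fun X hX =>
    Submodule.map_comap_eq_self (by rwa [Submodule.range_subtype])
  have hVT : ∀ i, V i ≤ T := fun i => hT ▸ le_sup_of_le_left (le_iSup V i)
  have hUT : ∀ i, U i ≤ T := fun i => hT ▸ le_sup_of_le_right (le_iSup U i)
  obtain ⟨V, rfl⟩ : ∃ V₁ : Fin (Fintype.card K + 1) → Submodule K T,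
      V = fun i => (V₁ i).map T.subtype := ⟨_, funext fun i => (hmap _ (hVT i)).symm⟩
  obtain ⟨U, rfl⟩ : ∃ U₁ : Fin (Fintype.card K + 1) → Submodule K T,
      U = fun i => (U₁ i).map T.subtype := ⟨_, funext fun i => (hmap _ (hUT i)).symm⟩
  have hinj := T.subtype_injective
  obtain ⟨U', V', hequiv, htype⟩ := exists_isType_of_forall_dual
    ((isometrySolution_map_iff hinj).1 hsol) (fun h => hnontriv (h.map _)) fun f hfV hfU => by
      have hT' : T ≤ (LinearMap.ker f).map T.subtype := hT.trans_le <| sup_le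
        (iSup_le fun i => Submodule.map_mono ((Submodule.mem_dualAnnihilator f).1 (hfV i)))
        (iSup_le fun i => Submodule.map_mono ((Submodule.mem_dualAnnihilator f).1 (hfU i)))
      ext t
      obtain ⟨s, hs, hst⟩ := hT' t.2
      exact hinj hst ▸ hs
  exact ⟨_, _, hequiv.imp (fun h => ⟨h.1.map _, h.2.map _⟩) fun h => ⟨h.1.map _, h.2.map _⟩,
    htype.imp (·.map hinj) (Or.imp (·.map hinj) (·.map hinj))⟩
end

section
/- Let K be a finite field with |K| = q, let W be a finite-dimensional K-vector space, and let m = q+1. For any tuple V = (V_1,…,V_m) of K-subspaces of W, there is at most one tuple U up to equivalence such that (U,V) is a nontrivial solution of the isometry equation: if (U,V) and (U′,V) are both nontrivial solutions, then U and U′ are equivalent tuples. -/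
open Finset
open scoped Classical

section Covering

variable {K E ι : Type*} [Field K] [AddCommGroup E] [Module K E]

/-- If the subspaces `A i`, `i ∈ F`, cover `X`, the point `x ∈ X` lies in none of them except
possibly `A k`, and `z ∈ X` is not in `A k ∋ x`, then the points of the affine line `z + K x`
are covered injectively by the remaining subspaces. -/
lemma exists_injective_cover_line {A : ι → Submodule K E} {X : Submodule K E} {F : Finset ι}
    (hcov : ∀ x ∈ X, ∃ i ∈ F, x ∈ A i) {k : ι} {x z : E} (hxX : x ∈ X) (hxk : x ∈ A k)
    (hx : ∀ j ∈ F, j ≠ k → x ∉ A j) (hzX : z ∈ X) (hz : z ∉ A k) :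
    ∃ f : K → ι, Function.Injective f ∧ ∀ a, f a ∈ F.erase k ∧ z + a • x ∈ A (f a) := by
  choose f hfF hf using fun a : K => hcov (z + a • x) (X.add_mem hzX (X.smul_mem a hxX))
  have hfk : ∀ a, f a ≠ k := by
    intro a h
    have h1 := hf a
    rw [h] at h1
    exact hz (((A k).add_mem_iff_left ((A k).smul_mem a hxk)).1 h1)
  refine ⟨f, fun a b hab => ?_, fun a => ⟨mem_erase.2 ⟨hfk a, hfF a⟩, hf a⟩⟩
  by_contra hne
  have h1 := hf a
  rw [hab] at h1
  have h2 := (A (f b)).sub_mem h1 (hf b)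
  rw [add_sub_add_left_eq_sub, ← sub_smul] at h2
  exact hx _ (hfF b) (hfk b) (((A (f b)).smul_mem_iff (sub_ne_zero.2 hne)).1 h2)

variable [Fintype K]

/-- A vector space over a field with `q` elements is not covered by `q` proper subspaces. -/
lemma card_lt_card_of_cover {A : ι → Submodule K E} {X : Submodule K E} {F : Finset ι}
    (hcov : ∀ x ∈ X, ∃ i ∈ F, x ∈ A i) (hprop : ∀ i ∈ F, ¬ X ≤ A i) :
    Fintype.card K < F.card := by
  induction F using Finset.strongInduction with
  | H F ih =>
    by_cases hmin : ∃ k ∈ F, ∀ x ∈ X, ∃ i ∈ F.erase k, x ∈ A i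
    · obtain ⟨k, hk, h⟩ := hmin
      exact (ih _ (erase_ssubset hk) h fun i hi => hprop i (mem_of_mem_erase hi)).trans
        (card_lt_card (erase_ssubset hk))
    · push Not at hmin
      obtain ⟨k, hk, -⟩ := hcov 0 X.zero_mem
      obtain ⟨x, hxX, hx⟩ := hmin k hk
      obtain ⟨z, hzX, hz⟩ := SetLike.not_le_iff_exists.1 (hprop k hk)
      have hx' : ∀ j ∈ F, j ≠ k → x ∉ A j := fun j hj hjk => hx j (mem_erase.2 ⟨hjk, hj⟩)
      have hxk : x ∈ A k := by
        obtain ⟨i, hi, hxi⟩ := hcov x hxX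
        by_contra hxk
        exact hx' i hi (fun h => hxk (h ▸ hxi)) hxi
      obtain ⟨f, hinj, hf⟩ := exists_injective_cover_line hcov hxX hxk hx' hzX hz
      have := card_le_card_of_injOn (s := univ) f (fun a _ => (hf a).1) hinj.injOn
      rw [card_erase_of_mem hk, card_univ] at this
      have := card_pos.2 ⟨k, hk⟩
      omega

variable [Fintype ι] {A : ι → Submodule K E} {X : Submodule K E}
  (hcard : Fintype.card ι = Fintype.card K + 1)
  (hcov : ∀ x ∈ X, ∃ i, x ∈ A i)

include hcard hcov

lemma exists_bijective_cover_line {k : ι} {x z : E} (hxX : x ∈ X) (hxk : x ∈ A k)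
    (hx : ∀ j, j ≠ k → x ∉ A j) (hzX : z ∈ X) (hz : z ∉ A k) :
    ∃ f : K → ι, (∀ a, z + a • x ∈ A (f a)) ∧ ∀ j, j ≠ k → ∃ a, f a = j := by
  obtain ⟨f, hinj, hf⟩ := exists_injective_cover_line (F := univ)
    (fun x hx => by simpa using hcov x hx) hxX hxk (fun j _ => hx j) hzX hz
  refine ⟨f, fun a => (hf a).2, fun j hj => ?_⟩
  have := surj_on_of_inj_on_of_card_le (s := univ) (t := univ.erase k) (fun a _ => f a)
    (fun a _ => (hf a).1) (fun a b _ _ h => hinj h)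
    (by rw [card_erase_of_mem (mem_univ k), card_univ, card_univ]; omega) j (by simp [hj])
  obtain ⟨a, -, ha⟩ := this
  exact ⟨a, ha.symm⟩

variable (hprop : ∀ i, ¬ X ≤ A i)

include hprop

lemma exists_private_of_cover (k : ι) : ∃ x ∈ X, x ∈ A k ∧ ∀ j, j ≠ k → x ∉ A j := by
  by_contra! h
  have := card_lt_card_of_cover (A := A) (X := X) (F := univ.erase k) (fun x hx => by
    obtain ⟨i, hi⟩ := hcov x hx
    by_cases hik : i = k
    · obtain ⟨j, hj, hxj⟩ := h x hx (hik ▸ hi)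
      exact ⟨j, by simp [hj], hxj⟩
    · exact ⟨i, by simp [hik], hi⟩) fun i _ => hprop i
  rw [card_erase_of_mem (mem_univ k), card_univ] at this
  omega

lemma mem_of_mem_two_of_cover {w : E} (hw : w ∈ X) {j k : ι} (hjk : j ≠ k) (hj : w ∈ A j)
    (hk : w ∈ A k) (i : ι) : w ∈ A i := by
  by_contra hi
  obtain ⟨x, hxX, hxi, hx⟩ := exists_private_of_cover hcard hcov hprop i
  obtain ⟨f, hf, hsurj⟩ := exists_bijective_cover_line hcard hcov hxX hxi hx hw hi
  have key : ∀ l, w ∈ A l → l = f 0 := by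
    intro l hl
    have hli : l ≠ i := fun h => hi (h ▸ hl)
    obtain ⟨a, rfl⟩ := hsurj l hli
    by_contra hne
    have ha : a ≠ 0 := fun h => hne (by rw [h])
    exact hx _ hli (((A (f a)).smul_mem_iff ha).1 (((A (f a)).add_mem_iff_right hl).1 (hf a)))
  exact hjk ((key j hj).trans (key k hk).symm)

variable [FiniteDimensional K E]

lemma finrank_inf_of_cover_s18 (j : ι) :
    Module.finrank K ↥(A j ⊓ X) + 1 = Module.finrank K X := by
  have : Nontrivial ι := Fintype.one_lt_card_iff_nontrivial.1 (by
    have := Fintype.one_lt_card (α := K); omega)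
  obtain ⟨i, hij⟩ := exists_ne j
  obtain ⟨x, hxX, hxi, hx⟩ := exists_private_of_cover hcard hcov hprop i
  have hxj := hx j hij.symm
  rw [← Submodule.finrank_sup_span_singleton (p := A j ⊓ X) (v := x) fun h => hxj h.1]
  have hmem : ∀ z ∈ X, z ∉ A i → z ∈ (A j ⊓ X) ⊔ Submodule.span K {x} := by
    intro z hzX hz
    obtain ⟨f, hf, hsurj⟩ := exists_bijective_cover_line hcard hcov hxX hxi hx hzX hz
    obtain ⟨a, rfl⟩ := hsurj j hij.symm
    refine Submodule.mem_sup.2 ⟨z + a • x, ⟨hf a, X.add_mem hzX (X.smul_mem a hxX)⟩, -(a • x), ?_,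
      by abel⟩
    exact neg_mem (Submodule.smul_mem _ _ (Submodule.mem_span_singleton_self x))
  obtain ⟨y, hyX, hy⟩ := SetLike.not_le_iff_exists.1 (hprop i)
  suffices h : (A j ⊓ X) ⊔ Submodule.span K {x} = X by rw [h]
  refine le_antisymm
    (sup_le inf_le_right ((Submodule.span_singleton_le_iff_mem _ _).2 hxX)) fun z hz => ?_
  by_cases hzi : z ∈ A i
  · have := sub_mem (hmem (z + y) (X.add_mem hz hyX)
      (fun h => hy (((A i).add_mem_iff_right hzi).1 h))) (hmem y hyX hy)
    simpa using this
  · exact hmem z hz hzi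

lemma finrank_inf_inf_of_cover {i j : ι} (hij : i ≠ j) :
    Module.finrank K ↥((A i ⊓ X) ⊓ (A j ⊓ X)) + 2 = Module.finrank K X := by
  have hi := finrank_inf_of_cover_s18 hcard hcov hprop i
  have hj := finrank_inf_of_cover_s18 hcard hcov hprop j
  obtain ⟨x, hxX, hxj, hx⟩ := exists_private_of_cover hcard hcov hprop j
  have hle : Module.finrank K ↥((A i ⊓ X) ⊔ (A j ⊓ X)) ≤ Module.finrank K X :=
    Submodule.finrank_mono (sup_le inf_le_right inf_le_right)
  have hlt : Module.finrank K ↥(A i ⊓ X) < Module.finrank K ↥((A i ⊓ X) ⊔ (A j ⊓ X)) := by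
    refine Submodule.finrank_lt_finrank_of_lt (lt_of_le_of_ne le_sup_left fun h => ?_)
    have : x ∈ (A i ⊓ X) ⊔ (A j ⊓ X) := Submodule.mem_sup_right ⟨hxj, hxX⟩
    rw [← h] at this
    exact hx i hij this.1
  have := Submodule.finrank_sup_add_finrank_inf_eq (A i ⊓ X) (A j ⊓ X)
  omega

end Covering

section EqualCounts

variable {K E : Type*} [Field K] [Fintype K] [AddCommGroup E] [Module K E]

lemma exists_mem_le_of_countP_eq {s t : Multiset (Submodule K E)}
    (h : ∀ w, s.countP (w ∈ ·) = t.countP (w ∈ ·)) (ht : t.card ≤ Fintype.card K)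
    {X : Submodule K E} (hX : X ∈ s) : ∃ Y ∈ t, X ≤ Y := by
  by_contra! hlt
  have := card_lt_card_of_cover (A := id) (X := X) (F := t.toFinset) (fun x hx => by
    have : 0 < t.countP (x ∈ ·) := by
      rw [← h]
      exact Multiset.countP_pos.2 ⟨X, hX, hx⟩
    obtain ⟨Y, hY, hxY⟩ := Multiset.countP_pos.1 this
    exact ⟨Y, by simpa using hY, hxY⟩) (fun Y hY => hlt Y (by simpa using hY))
  have := Multiset.toFinset_card_le t
  omega

variable [FiniteDimensional K E]

/-- Multisets of at most `q` subspaces are determined by the sum of their indicator functions. -/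
lemma eq_of_countP_eq {s t : Multiset (Submodule K E)}
    (h : ∀ w, s.countP (w ∈ ·) = t.countP (w ∈ ·)) (ht : t.card ≤ Fintype.card K) : s = t := by
  have hcard : s.card = t.card := by
    have := h 0
    rwa [Multiset.countP_eq_card.2 (fun Y _ => Y.zero_mem),
      Multiset.countP_eq_card.2 (fun Y _ => Y.zero_mem)] at this
  induction hn : t.card generalizing s t with
  | zero =>
    rw [Multiset.card_eq_zero.1 hn, Multiset.card_eq_zero.1 (hcard.trans hn)]
  | succ n ih =>
    obtain ⟨Y, hYs, hYt⟩ : ∃ Y ∈ s, Y ∈ t := by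
      obtain ⟨X, hX, hmax⟩ := exists_max_image (s + t).toFinset (fun Y => Module.finrank K Y) (by
        obtain ⟨Y, hY⟩ := Multiset.card_pos_iff_exists_mem.1 (by omega : 0 < t.card)
        exact ⟨Y, by simp [hY]⟩)
      simp only [Multiset.mem_toFinset, Multiset.mem_add] at hX hmax
      rcases hX with hX | hX
      · obtain ⟨Y, hY, hXY⟩ := exists_mem_le_of_countP_eq h ht hX
        exact ⟨Y, Submodule.eq_of_le_of_finrank_le hXY (hmax Y (.inr hY)) ▸ hX, hY⟩
      · obtain ⟨Y, hY, hXY⟩ := exists_mem_le_of_countP_eq (fun w => (h w).symm)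
          (hcard.trans_le ht) hX
        exact ⟨Y, hY, Submodule.eq_of_le_of_finrank_le hXY (hmax Y (.inl hY)) ▸ hX⟩
    obtain ⟨s', rfl⟩ := Multiset.exists_cons_of_mem hYs
    obtain ⟨t', rfl⟩ := Multiset.exists_cons_of_mem hYt
    simp only [Multiset.card_cons] at hcard hn ht
    rw [ih (s := s') (t := t') (fun w => by
      have := h w
      simp only [Multiset.countP_cons] at this
      omega) (by omega) (by omega) (by omega)]

variable {ι : Type*} [Fintype ι]

lemma exists_perm_of_map_eq {α : Type*} {A B : ι → α}
    (h : univ.val.map A = univ.val.map B) : ∃ π : Equiv.Perm ι, ∀ i, B i = A (π i) := by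
  have e : ∀ c, Nonempty ({i // B i = c} ≃ {i // A i = c}) := by
    intro c
    refine Fintype.card_eq.1 ?_
    have := congrArg (Multiset.count c) h
    simp only [Multiset.count_map] at this
    simp only [Fintype.card_subtype, Finset.card_def, Finset.filter_val]
    simpa only [eq_comm] using this.symm
  exact ⟨Equiv.ofFiberEquiv fun c => (e c).some, fun i => (Equiv.ofFiberEquiv_map _ i).symm⟩

/-- Inequivalent families of `q + 1` subspaces with the same sum of indicator functions have no
member in common. -/
lemma ne_of_card_eq_of_not_equiv {A B : ι → Submodule K E}
    (hcard : Fintype.card ι = Fintype.card K + 1)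
    (h : ∀ w, #{i | w ∈ A i} = #{i | w ∈ B i})
    (hne : ¬ ∃ π : Equiv.Perm ι, ∀ i, B i = A (π i)) (i j : ι) : A i ≠ B j := by
  intro hij
  obtain ⟨s, hs⟩ := Multiset.exists_cons_of_mem (Multiset.mem_map_of_mem A (mem_univ_val i))
  obtain ⟨t, ht⟩ := Multiset.exists_cons_of_mem (Multiset.mem_map_of_mem B (mem_univ_val j))
  refine hne (exists_perm_of_map_eq ?_)
  have htc := congrArg Multiset.card ht
  simp only [Multiset.card_map, Multiset.card_cons, card_val, card_univ] at htc
  rw [hs, ht, hij, eq_of_countP_eq (s := s) (t := t) (fun w => ?_) (by omega)]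
  have hw : (univ.val.map A).countP (w ∈ ·) = (univ.val.map B).countP (w ∈ ·) := by
    simpa only [Multiset.countP_map, Finset.card_def, Finset.filter_val] using h w
  simp only [hs, ht, Multiset.countP_cons, hij] at hw
  omega

lemma exists_of_card_filter_eq {p r : ι → Prop} (h : #{i | p i} = #{i | r i})
    (hp : ∃ i, p i) : ∃ i, r i := by
  obtain ⟨i, hi⟩ := hp
  have : 0 < #{i | r i} := h ▸ card_pos.2 ⟨i, by simpa using hi⟩
  obtain ⟨j, hj⟩ := card_pos.1 this
  exact ⟨j, by simpa using hj⟩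

lemma exists_two_of_card_filter_eq {p r : ι → Prop} (h : #{i | p i} = #{i | r i}) {i j : ι}
    (hij : i ≠ j) (hi : p i) (hj : p j) : ∃ k l, k ≠ l ∧ r k ∧ r l := by
  have : 1 < #{i | r i} := h ▸ one_lt_card.2 ⟨i, by simpa using hi, j, by simpa using hj, hij⟩
  obtain ⟨k, hk, l, hl, hkl⟩ := one_lt_card.1 this
  exact ⟨k, l, hkl, by simpa using hk, by simpa using hl⟩

lemma forall_of_card_filter_eq {p r : ι → Prop} (h : #{i | p i} = #{i | r i})
    (hp : ∀ i, p i) (i : ι) : r i := by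
  rw [filter_true_of_mem fun i _ => hp i] at h
  exact filter_card_eq h.symm i (mem_univ i)

omit [Fintype K] [FiniteDimensional K E] in
lemma iInf_eq_of_card_filter_eq {A B : ι → Submodule K E}
    (h : ∀ w, #{i | w ∈ A i} = #{i | w ∈ B i}) : ⨅ i, A i = ⨅ i, B i := by
  ext w
  simp only [Submodule.mem_iInf]
  exact ⟨forall_of_card_filter_eq (h w), forall_of_card_filter_eq (h w).symm⟩

section Maximal

variable {A B : ι → Submodule K E} (hcard : Fintype.card ι = Fintype.card K + 1)
  (h : ∀ w, #{i | w ∈ A i} = #{i | w ∈ B i}) (hne : ∀ i j, A i ≠ B j)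
  {b : ι} (hmax : ∀ i, Module.finrank K (A i) ≤ Module.finrank K (B b))

include hcard h hne hmax

lemma exists_private_of_finrank_max (i : ι) : ∃ x ∈ B b, x ∈ A i ∧ ∀ j, j ≠ i → x ∉ A j :=
  exists_private_of_cover hcard (fun x hx => exists_of_card_filter_eq (h x).symm ⟨b, hx⟩)
    (fun i hi => hne i b (Submodule.eq_of_le_of_finrank_le hi (hmax i)).symm) i

lemma finrank_inf_of_finrank_max (i : ι) :
    Module.finrank K ↥(A i ⊓ B b) + 1 = Module.finrank K (B b) :=
  finrank_inf_of_cover_s18 hcard (fun x hx => exists_of_card_filter_eq (h x).symm ⟨b, hx⟩)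
    (fun i hi => hne i b (Submodule.eq_of_le_of_finrank_le hi (hmax i)).symm) i

lemma mem_iInf_of_finrank_max {w : E} (hw : w ∈ B b) {i j : ι} (hij : i ≠ j) (hi : w ∈ A i)
    (hj : w ∈ A j) : w ∈ ⨅ k, A k :=
  (Submodule.mem_iInf _).2 <|
    mem_of_mem_two_of_cover hcard (fun x hx => exists_of_card_filter_eq (h x).symm ⟨b, hx⟩)
    (fun i hi => hne i b (Submodule.eq_of_le_of_finrank_le hi (hmax i)).symm) hw hij hi hj

lemma finrank_iInf_of_finrank_max :
    Module.finrank K ↥(⨅ i, A i) + 2 = Module.finrank K (B b) := by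
  have : Nontrivial ι := Fintype.one_lt_card_iff_nontrivial.1 (by
    have := Fintype.one_lt_card (α := K); omega)
  obtain ⟨i, j, hij⟩ := exists_pair_ne ι
  rw [← finrank_inf_inf_of_cover hcard
    (fun x hx => exists_of_card_filter_eq (h x).symm ⟨b, hx⟩)
    (fun i hi => hne i b (Submodule.eq_of_le_of_finrank_le hi (hmax i)).symm) hij]
  suffices hS : ⨅ k, A k = (A i ⊓ B b) ⊓ (A j ⊓ B b) by rw [hS]
  have hle : ⨅ k, A k ≤ B b := iInf_eq_of_card_filter_eq h ▸ iInf_le B b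
  exact le_antisymm (le_inf (le_inf (iInf_le A i) hle) (le_inf (iInf_le A j) hle))
    fun w hw => mem_iInf_of_finrank_max hcard h hne hmax hw.1.2 hij hw.1.1 hw.2.1

lemma inf_le_iInf_of_finrank_max {k : ι} (hk : k ≠ b) : B b ⊓ B k ≤ ⨅ i, A i := by
  intro w hw
  obtain ⟨i, j, hij, hi, hj⟩ := exists_two_of_card_filter_eq (h w).symm hk hw.2 hw.1
  exact mem_iInf_of_finrank_max hcard h hne hmax hw.1 hij hi hj

end Maximal

section ThreeFamilies

variable {A B C : ι → Submodule K E} (hcard : Fintype.card ι = Fintype.card K + 1)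
  (hAB : ∀ w, #{i | w ∈ A i} = #{i | w ∈ B i}) (hCB : ∀ w, #{i | w ∈ C i} = #{i | w ∈ B i})
  (neAB : ∀ i j, A i ≠ B j) (neCB : ∀ i j, C i ≠ B j) (neAC : ∀ i j, A i ≠ C j)
  {b : ι} (maxA : ∀ i, Module.finrank K (A i) ≤ Module.finrank K (B b))
  (maxC : ∀ i, Module.finrank K (C i) ≤ Module.finrank K (B b))

include hcard hAB hCB neAB neCB neAC maxA maxC

/-- The covers of a largest member `B b` by the `A i` and by the `C i` consist of the same
hyperplanes, so they cannot both be made of subspaces of `B b`. -/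
lemma not_forall_le_of_finrank_max (a : ι) (ha : A a ≤ B b) : ¬ ∀ i, C i ≤ B b := by
  intro hC
  obtain ⟨x, hxB, hxa, hx⟩ := exists_private_of_finrank_max hcard hAB neAB maxA a
  obtain ⟨c, hxc⟩ := exists_of_card_filter_eq (hCB x).symm ⟨b, hxB⟩
  have : Nontrivial ι := Fintype.one_lt_card_iff_nontrivial.1 (by
    have := Fintype.one_lt_card (α := K); omega)
  obtain ⟨j, hj⟩ := exists_ne a
  have hS := finrank_iInf_of_finrank_max hcard hAB neAB maxA
  have h1 := finrank_inf_of_finrank_max hcard hAB neAB maxA a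
  have h2 := finrank_inf_of_finrank_max hcard hCB neCB maxC c
  rw [inf_eq_left.2 ha] at h1
  rw [inf_eq_left.2 (hC c)] at h2
  have hlt : ⨅ i, A i < A a ⊓ C c := by
    refine lt_of_le_of_ne (le_inf (iInf_le A a) ?_) fun h => ?_
    · rw [iInf_eq_of_card_filter_eq hAB, ← iInf_eq_of_card_filter_eq hCB]
      exact iInf_le C c
    · have hxS : x ∈ ⨅ i, A i := h ▸ ⟨hxa, hxc⟩
      exact hx j hj ((Submodule.mem_iInf _).1 hxS j)
  have h3 := Submodule.finrank_lt_finrank_of_lt hlt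
  exact neAC a c ((Submodule.eq_of_le_of_finrank_le inf_le_left (by omega)).symm.trans
    (Submodule.eq_of_le_of_finrank_le inf_le_right (by omega)))

lemma le_of_finrank_max (a : ι) : A a ≤ B b := by
  by_contra ha
  have hAC : ∀ w, #{i | w ∈ A i} = #{i | w ∈ C i} := fun w => (hAB w).trans (hCB w).symm
  have hS := finrank_iInf_of_finrank_max hcard hAB neAB maxA
  have hSAC := iInf_eq_of_card_filter_eq hAC
  have hL := finrank_inf_of_finrank_max hcard hAB neAB maxA a
  have hdim : Module.finrank K (A a) = Module.finrank K (B b) := by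
    have := Submodule.finrank_lt_finrank_of_lt
      (lt_of_le_of_ne (inf_le_left : A a ⊓ B b ≤ A a) fun h => ha (inf_eq_left.1 h))
    have := maxA a
    omega
  obtain ⟨x, hxB, hxa, hx⟩ := exists_private_of_finrank_max hcard hAB neAB maxA a
  obtain ⟨c, hxc⟩ := exists_of_card_filter_eq (hCB x).symm ⟨b, hxB⟩
  have : Nontrivial ι := Fintype.one_lt_card_iff_nontrivial.1 (by
    have := Fintype.one_lt_card (α := K); omega)
  have hxC : ∀ j, j ≠ c → x ∉ C j := by
    intro j hj hxj
    obtain ⟨k, l, hkl, hk, hl⟩ := exists_two_of_card_filter_eq (hAC x).symm hj hxj hxc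
    have hxS := mem_iInf_of_finrank_max hcard hAB neAB maxA hxB hkl hk hl
    obtain ⟨i, hi⟩ := exists_ne a
    exact hx i hi ((Submodule.mem_iInf _).1 hxS i)
  have maxC' : ∀ i, Module.finrank K (C i) ≤ Module.finrank K (A a) := fun i =>
    (maxC i).trans_eq hdim.symm
  -- every other `C j` is spanned by its hyperplanes `C j ⊓ A a` and `C j ⊓ B b`
  have hC : ∀ j, j ≠ c → C j ≤ A a ⊔ B b ∧ Module.finrank K (C j) = Module.finrank K (B b) := by
    intro j hj
    have h1 := finrank_inf_of_finrank_max hcard hCB neCB maxC j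
    have h2 := finrank_inf_of_finrank_max hcard (fun w => (hAC w).symm)
      (fun i j => (neAC j i).symm) maxC' j
    have h3 := Submodule.finrank_sup_add_finrank_inf_eq (C j ⊓ A a) (C j ⊓ B b)
    have hlt : (C j ⊓ A a) ⊓ (C j ⊓ B b) < A a ⊓ B b := by
      refine lt_of_le_of_ne (inf_le_inf inf_le_right inf_le_right) fun h => hxC j hj ?_
      have : x ∈ (C j ⊓ A a) ⊓ (C j ⊓ B b) := h ▸ ⟨hxa, hxB⟩
      exact this.1.1
    have h4 := Submodule.finrank_lt_finrank_of_lt hlt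
    have hle : (C j ⊓ A a) ⊔ (C j ⊓ B b) ≤ C j := sup_le inf_le_left inf_le_left
    have h5 := maxC j
    have heq := Submodule.eq_of_le_of_finrank_le hle (by omega)
    refine ⟨heq ▸ sup_le_sup inf_le_right inf_le_right, le_antisymm h5 ?_⟩
    have h6 := Submodule.finrank_mono hle
    omega
  obtain ⟨j, hj, k, hk, hjk⟩ := one_lt_card.1 (show 1 < #(univ.erase c) by
    rw [card_erase_of_mem (mem_univ c), card_univ]
    have := Fintype.one_lt_card (α := K); omega)
  obtain ⟨hjle, hjdim⟩ := hC j (ne_of_mem_erase hj)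
  obtain ⟨hkle, hkdim⟩ := hC k (ne_of_mem_erase hk)
  have h1 := Submodule.finrank_mono (sup_le hjle hkle)
  have h2 := Submodule.finrank_sup_add_finrank_inf_eq (A a) (B b)
  have h3 := Submodule.finrank_sup_add_finrank_inf_eq (C j) (C k)
  have h4 := Submodule.finrank_mono (inf_le_iInf_of_finrank_max hcard hAC neAC
    (fun i => (maxA i).trans_eq hjdim.symm) hjk.symm)
  omega

lemma false_of_finrank_max : False :=
  not_forall_le_of_finrank_max hcard hAB hCB neAB neCB neAC maxA maxC b
    (le_of_finrank_max hcard hAB hCB neAB neCB neAC maxA maxC b)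
    (le_of_finrank_max hcard hCB hAB neCB neAB (fun i j => (neAC j i).symm) maxC maxA)

end ThreeFamilies

/-- Three families of `q + 1` subspaces with the same sum of indicator functions cannot be
pairwise without common members. -/
lemma not_pairwise_ne_of_card_filter_eq {A B C : ι → Submodule K E}
    (hcard : Fintype.card ι = Fintype.card K + 1)
    (hAB : ∀ w, #{i | w ∈ A i} = #{i | w ∈ B i}) (hCB : ∀ w, #{i | w ∈ C i} = #{i | w ∈ B i})
    (neAB : ∀ i j, A i ≠ B j) (neCB : ∀ i j, C i ≠ B j) (neAC : ∀ i j, A i ≠ C j) : False := by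
  have : Nonempty ι := Fintype.card_pos_iff.1 (by omega)
  obtain ⟨a, ha⟩ := Finite.exists_max fun i => Module.finrank K (A i)
  obtain ⟨b, hb⟩ := Finite.exists_max fun i => Module.finrank K (B i)
  obtain ⟨c, hc⟩ := Finite.exists_max fun i => Module.finrank K (C i)
  have hmax : ∀ {x y : ℕ} {D : ι → Submodule K E}, (∀ i, Module.finrank K (D i) ≤ x) → x ≤ y →
      ∀ i, Module.finrank K (D i) ≤ y := fun h hxy i => (h i).trans hxy
  have hCA := fun w => (hCB w).trans (hAB w).symm
  have hBA := fun w => (hAB w).symm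
  have hBC := fun w => (hCB w).symm
  have hAC := fun w => (hCA w).symm
  have neBA := fun i j => (neAB j i).symm
  have neBC := fun i j => (neCB j i).symm
  have neCA := fun i j => (neAC j i).symm
  rcases le_total (Module.finrank K (A a)) (Module.finrank K (B b)) with h1 | h1
  · rcases le_total (Module.finrank K (C c)) (Module.finrank K (B b)) with h2 | h2
    · exact false_of_finrank_max hcard hAB hCB neAB neCB neAC (hmax ha h1) (hmax hc h2)
    · exact false_of_finrank_max hcard hAC hBC neAC neBC neAB (hmax ha (h1.trans h2))
        (hmax hb h2)
  · rcases le_total (Module.finrank K (C c)) (Module.finrank K (A a)) with h2 | h2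
    · exact false_of_finrank_max hcard hBA hCA neBA neCA neBC (hmax hb h1) (hmax hc h2)
    · exact false_of_finrank_max hcard hAC hBC neAC neBC neAB (hmax ha h2)
        (hmax hb (h1.trans h2))

end EqualCounts

section Duality

variable {K W : Type*} [Field K] [Fintype K] [AddCommGroup W] [Module K W]

lemma inv_card_mul_card_ker_inf [FiniteDimensional K W] (V : Submodule K W)
    (φ : Module.Dual K W) :
    (Nat.card V : ℝ)⁻¹ * Nat.card ↥(LinearMap.ker (φ ∘ₗ V.subtype)) =
      (Fintype.card K : ℝ)⁻¹ + (1 - (Fintype.card K : ℝ)⁻¹) *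
        (if φ ∈ V.dualAnnihilator then 1 else 0) := by
  have hq : (Fintype.card K : ℝ) ≠ 0 := by positivity
  have hV : Nat.card V = Fintype.card K ^ Module.finrank K V := by
    rw [Module.natCard_eq_pow_finrank (K := K), Nat.card_eq_fintype_card]
  have hker : Nat.card ↥(LinearMap.ker (φ ∘ₗ V.subtype)) =
      Fintype.card K ^ Module.finrank K (LinearMap.ker (φ ∘ₗ V.subtype)) := by
    rw [Module.natCard_eq_pow_finrank (K := K), Nat.card_eq_fintype_card]
  have hφ : φ ∈ V.dualAnnihilator ↔ φ ∘ₗ V.subtype = 0 := by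
    simp [Submodule.mem_dualAnnihilator, LinearMap.ext_iff]
  rw [hV, hker]
  by_cases h : φ ∘ₗ V.subtype = 0
  · rw [if_pos (hφ.2 h), h, LinearMap.ker_zero, finrank_top]
    push_cast
    field_simp
    ring
  · rw [if_neg (mt hφ.1 h), ← Module.Dual.finrank_ker_add_one_of_ne_zero h]
    push_cast
    field_simp
    ring

omit [Fintype K] in
lemma sum_ker_indicator [Fintype W] (V : Submodule K W) (φ : Module.Dual K W) :
    ∑ w with φ w = 0, (if w ∈ V then (1 : ℝ) else 0) =
      Nat.card ↥(LinearMap.ker (φ ∘ₗ V.subtype)) := by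
  rw [sum_boole, filter_filter, Nat.cast_inj, ← Fintype.card_subtype, ← Nat.card_eq_fintype_card]
  exact Nat.card_congr
    { toFun := fun w => ⟨⟨w.1, w.2.2⟩, w.2.1⟩
      invFun := fun w => ⟨w.1.1, w.2, w.1.2⟩
      left_inv := fun _ => rfl
      right_inv := fun _ => rfl }

/-- The isometry equation says that the annihilators have the same sum of indicator functions. -/
lemma IsometrySolution.card_dualAnnihilator_eq [FiniteDimensional K W] {m : ℕ}
    {U V : Fin m → Submodule K W} (h : IsometrySolution U V) (φ : Module.Dual K W) :
    #{i | φ ∈ (U i).dualAnnihilator} = #{i | φ ∈ (V i).dualAnnihilator} := by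
  have : Finite W := Module.finite_of_finite K
  have : Fintype W := Fintype.ofFinite W
  have hq : (1 : ℝ) - (Fintype.card K : ℝ)⁻¹ ≠ 0 := by
    have : (1 : ℝ) < Fintype.card K := by exact_mod_cast Fintype.one_lt_card (α := K)
    exact (sub_pos.2 (inv_lt_one_of_one_lt₀ this)).ne'
  have key : ∀ A : Fin m → Submodule K W,
      ∑ w with φ w = 0, ∑ i, ((Nat.card ↥(A i) : ℝ))⁻¹ * (if w ∈ A i then 1 else 0) =
        m * (Fintype.card K : ℝ)⁻¹ + (1 - (Fintype.card K : ℝ)⁻¹) *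
          #{i | φ ∈ (A i).dualAnnihilator} := by
    intro A
    rw [sum_comm]
    simp_rw [← mul_sum, sum_ker_indicator, inv_card_mul_card_ker_inf, sum_add_distrib, ← mul_sum,
      sum_boole]
    simp
  have := key U
  rw [← sum_congr rfl fun w _ => h w, key V] at this
  exact_mod_cast (mul_left_cancel₀ hq (add_left_cancel this)).symm

end Duality

lemma tuplesEquiv_iff_dualAnnihilator {K W : Type*} [Field K] [AddCommGroup W] [Module K W]
    {m : ℕ} {U V : Fin m → Submodule K W} :
    TuplesEquiv U V ↔ ∃ π : Equiv.Perm (Fin m), ∀ i,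
      (V i).dualAnnihilator = (U (π i)).dualAnnihilator := by
  simp only [TuplesEquiv, Subspace.dualAnnihilator_inj]

/-- For a fixed tuple `V` of length `|K| + 1` there is, up to equivalence, at most one tuple
`U` such that `(U, V)` is a nontrivial solution of the isometry equation. -/
theorem nontrivial_solution_unique
    (K W : Type*) [Field K] [Fintype K] [AddCommGroup W] [Module K W]
    [FiniteDimensional K W]
    (V U U' : Fin (Fintype.card K + 1) → Submodule K W)
    (hsol : IsometrySolution U V) (hnontriv : ¬ TuplesEquiv U V)
    (hsol' : IsometrySolution U' V) (hnontriv' : ¬ TuplesEquiv U' V) :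
    TuplesEquiv U U' := by
  by_contra hUU'
  have hcard : Fintype.card (Fin (Fintype.card K + 1)) = Fintype.card K + 1 := Fintype.card_fin _
  have hUV := hsol.card_dualAnnihilator_eq
  have hU'V := hsol'.card_dualAnnihilator_eq
  rw [tuplesEquiv_iff_dualAnnihilator] at hnontriv hnontriv' hUU'
  exact not_pairwise_ne_of_card_filter_eq hcard hUV hU'V
    (ne_of_card_eq_of_not_equiv hcard hUV hnontriv)
    (ne_of_card_eq_of_not_equiv hcard hU'V hnontriv')
    (ne_of_card_eq_of_not_equiv hcard (fun w => (hUV w).trans (hU'V w).symm) hUU')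
end
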